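/- Let 𝒜 = H_0 + 𝒜_0 be a real affine space of self-adjoint operators on a Hilbert space ℋ over a real normed vector space 𝒜_0 of bounded self-adjoint perturbations, such that any two operators from 𝒜 are resolvent comparable and the norm ‖·‖_F of 𝒜_0 satisfies ‖V‖_F ≥ c‖R_z(H) V R_z(H)‖_1 for some constant c > 0, some H ∈ 𝒜 and some nonreal z. Then for any H_0, H_1 ∈ 𝒜 and any φ ∈ C_c^∞(ℝ), the trace formula Tr(φ(H_1) − φ(H_0)) = ξ(φ'; H_1, H_0) holds, where ξ(·; H_1, H_0) is the spectral shift measure. -/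

import Mathlib

open MeasureTheory Filter Complex Set Topology
open scoped InnerProductSpace ComplexInnerProductSpace ENNReal Topology Real
set_option autoImplicit false

noncomputable section

namespace SSF

variable {𝓗 : Type*} {𝓚 : Type*}

section TraceClass

variable [NormedAddCommGroup 𝓗] [InnerProductSpace ℂ 𝓗]
variable [NormedAddCommGroup 𝓚] [InnerProductSpace ℂ 𝓚]

/-- A bounded operator `T` on a Hilbert space is trace class iff the sums
`∑ |⟪e i, T (f i)⟫|` over finite orthonormal families `e,f` are uniformly bounded. -/
def IsTraceClass (T : 𝓗 →L[ℂ] 𝓗) : Prop :=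
  ∃ C : ℝ, ∀ (n : ℕ) (e f : Fin n → 𝓗), Orthonormal ℂ e → Orthonormal ℂ f →
    ∑ i, ‖⟪e i, T (f i)⟫_ℂ‖ ≤ C

/-- The trace norm of a bounded operator: the supremum of `∑ |⟪e i, T (f i)⟫|` over
finite orthonormal families `e,f`. -/
def traceNorm (T : 𝓗 →L[ℂ] 𝓗) : ℝ :=
  sSup {c : ℝ | ∃ (n : ℕ) (e f : Fin n → 𝓗), Orthonormal ℂ e ∧ Orthonormal ℂ f ∧
    c = ∑ i, ‖⟪e i, T (f i)⟫_ℂ‖}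

/-- The trace of a bounded operator, computed in a Hilbert basis (meaningful for
trace class operators). -/
def trace [CompleteSpace 𝓗] (T : 𝓗 →L[ℂ] 𝓗) : ℂ :=
  ∑' i : (exists_hilbertBasis ℂ 𝓗).choose, ⟪(i : 𝓗), T (i : 𝓗)⟫_ℂ

/-- A bounded operator between Hilbert spaces is Hilbert-Schmidt iff the sums
`∑ ‖T (e i)‖ ^ 2` over finite orthonormal families are uniformly bounded. -/
def IsHilbertSchmidt (T : 𝓗 →L[ℂ] 𝓚) : Prop :=
  ∃ C : ℝ, ∀ (n : ℕ) (e : Fin n → 𝓗), Orthonormal ℂ e → ∑ i, ‖T (e i)‖ ^ 2 ≤ C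

end TraceClass

variable [NormedAddCommGroup 𝓗] [InnerProductSpace ℂ 𝓗] [CompleteSpace 𝓗]
variable [NormedAddCommGroup 𝓚] [InnerProductSpace ℂ 𝓚] [CompleteSpace 𝓚]

/-- A (possibly unbounded) self-adjoint operator on a Hilbert space, bundled together
with its resolvent `R_z = (H - z)⁻¹` at every nonreal `z`. -/
structure SelfAdjointOperator (𝓗 : Type*) [NormedAddCommGroup 𝓗]
    [InnerProductSpace ℂ 𝓗] [CompleteSpace 𝓗] where
  domain : Submodule ℂ 𝓗
  dense_domain : Dense (domain : Set 𝓗)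
  op : domain →ₗ[ℂ] 𝓗
  symmetric : ∀ f g : domain, ⟪op f, (g : 𝓗)⟫_ℂ = ⟪(f : 𝓗), op g⟫_ℂ
  resolvent : ℂ → (𝓗 →L[ℂ] 𝓗)
  resolvent_mem : ∀ z : ℂ, z.im ≠ 0 → ∀ f : 𝓗, resolvent z f ∈ domain
  resolvent_right : ∀ (z : ℂ) (hz : z.im ≠ 0) (f : 𝓗),
    op ⟨resolvent z f, resolvent_mem z hz f⟩ - z • resolvent z f = f
  resolvent_left : ∀ (z : ℂ), z.im ≠ 0 → ∀ g : domain,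
    resolvent z (op g - z • (g : 𝓗)) = (g : 𝓗)

/-- `IsSum H0 V H1` encodes the relation `H1 = H0 + V` for a bounded perturbation `V`,
via the second resolvent identity (which characterises it uniquely). -/
def IsSum (H0 : SelfAdjointOperator 𝓗) (V : 𝓗 →L[ℂ] 𝓗)
    (H1 : SelfAdjointOperator 𝓗) : Prop :=
  ∀ z : ℂ, z.im ≠ 0 →
    H1.resolvent z - H0.resolvent z = -(H1.resolvent z ∘L (V ∘L H0.resolvent z))

/-- Two self-adjoint operators are resolvent comparable if the difference of their
resolvents at some (hence any) nonreal point is trace class. -/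
def ResolventComparable (H0 H1 : SelfAdjointOperator 𝓗) : Prop :=
  ∃ z : ℂ, z.im ≠ 0 ∧ IsTraceClass (H1.resolvent z - H0.resolvent z)

/-- The spectral measure of a self-adjoint operator `H`, bundled with the associated
scalar spectral measures, the Borel functional calculus, and the decomposition into
absolutely continuous and singular parts. -/
structure SpectralMeasure (H : SelfAdjointOperator 𝓗) where
  proj : Set ℝ → (𝓗 →L[ℂ] 𝓗)
  proj_sa : ∀ s, IsSelfAdjoint (proj s)
  proj_mul : ∀ s t, proj (s ∩ t) = proj s ∘L proj t
  proj_univ : proj Set.univ = 1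
  scalar : 𝓗 → Measure ℝ
  scalar_finite : ∀ f, IsFiniteMeasure (scalar f)
  scalar_spec : ∀ (f : 𝓗) (s : Set ℝ), MeasurableSet s →
    (scalar f s).toReal = (⟪f, proj s f⟫_ℂ).re
  resolvent_spec : ∀ (z : ℂ), z.im ≠ 0 → ∀ f : 𝓗,
    ⟪f, H.resolvent z f⟫_ℂ = ∫ x : ℝ, ((x : ℂ) - z)⁻¹ ∂(scalar f)
  fc : (ℝ → ℂ) → (𝓗 →L[ℂ] 𝓗)
  fc_spec : ∀ (φ : ℝ → ℂ), Measurable φ → (∃ C, ∀ x, ‖φ x‖ ≤ C) →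
    ∀ f : 𝓗, ⟪f, fc φ f⟫_ℂ = ∫ x : ℝ, φ x ∂(scalar f)
  acProj : Set ℝ → (𝓗 →L[ℂ] 𝓗)
  sProj : Set ℝ → (𝓗 →L[ℂ] 𝓗)
  acProj_add_sProj : ∀ s, acProj s + sProj s = proj s
  acScalar : 𝓗 → Measure ℝ
  sScalar : 𝓗 → Measure ℝ
  acScalar_spec : ∀ (f : 𝓗) (s : Set ℝ), MeasurableSet s →
    (acScalar f s).toReal = (⟪f, acProj s f⟫_ℂ).re
  sScalar_spec : ∀ (f : 𝓗) (s : Set ℝ), MeasurableSet s →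
    (sScalar f s).toReal = (⟪f, sProj s f⟫_ℂ).re
  acScalar_ac : ∀ f, acScalar f ≪ MeasureTheory.volume
  sScalar_sing : ∀ f, (sScalar f).MutuallySingular MeasureTheory.volume

/-- The real-valued test function version of the functional calculus. -/
def SpectralMeasure.fcR {H : SelfAdjointOperator 𝓗} (E : SpectralMeasure H)
    (φ : ℝ → ℝ) : 𝓗 →L[ℂ] 𝓗 :=
  E.fc fun x => (φ x : ℂ)


/-- `γ` has derivative `dγ r` at `r`, with respect to the norm function `nF`. -/
def HasPathDerivAt (nF : (𝓗 →L[ℂ] 𝓗) → ℝ) (γ dγ : ℝ → (𝓗 →L[ℂ] 𝓗)) (r : ℝ) : Prop :=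
  Tendsto (fun h : ℝ => nF ((((h : ℂ))⁻¹) • (γ (r + h) - γ r) - dγ r))
    (𝓝[≠] (0 : ℝ)) (𝓝 0)

/-- `γ` is a `C¹` path with derivative `dγ`, with respect to the norm function `nF`. -/
def IsC1Path (nF : (𝓗 →L[ℂ] 𝓗) → ℝ) (γ dγ : ℝ → (𝓗 →L[ℂ] 𝓗)) : Prop :=
  (∀ r : ℝ, HasPathDerivAt nF γ dγ r) ∧
  (∀ r : ℝ, Tendsto (fun s : ℝ => nF (dγ s - dγ r)) (𝓝 r) (𝓝 0))

/-- `γ` is a piecewise `C¹` path with derivative `dγ` (off a finite set),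
with respect to the norm function `nF`. -/
def IsPiecewiseC1Path (nF : (𝓗 →L[ℂ] 𝓗) → ℝ) (γ dγ : ℝ → (𝓗 →L[ℂ] 𝓗)) : Prop :=
  (∀ r : ℝ, Tendsto (fun s : ℝ => nF (γ s - γ r)) (𝓝 r) (𝓝 0)) ∧
  ∃ P : Finset ℝ, ∀ r ∉ P, HasPathDerivAt nF γ dγ r

/-- The setting of Section 2: a real affine space `𝒜 = H₀ + 𝒜₀` of self-adjoint
operators, over a real normed vector space `𝒜₀` of bounded self-adjoint perturbations,
such that any two operators of `𝒜` are resolvent comparable and the norm `nF` of `𝒜₀`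
dominates `V ↦ ‖R_z(H) V R_z(H)‖₁`.  The affine space is realised by the map
`opOf : V ↦ H₀ + V` (with `H₀ = opOf 0`), encoded via the second resolvent identity. -/
structure AffineSetting (𝓗 : Type*) [NormedAddCommGroup 𝓗] [InnerProductSpace ℂ 𝓗]
    [CompleteSpace 𝓗] where
  A0 : Set (𝓗 →L[ℂ] 𝓗)
  zero_mem : 0 ∈ A0
  add_mem : ∀ {V W}, V ∈ A0 → W ∈ A0 → V + W ∈ A0
  neg_mem : ∀ {V}, V ∈ A0 → -V ∈ A0
  smul_mem : ∀ (a : ℝ) {V}, V ∈ A0 → (a : ℂ) • V ∈ A0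
  sa_mem : ∀ V ∈ A0, IsSelfAdjoint V
  nF : (𝓗 →L[ℂ] 𝓗) → ℝ
  nF_nonneg : ∀ V, 0 ≤ nF V
  nF_eq_zero : ∀ V ∈ A0, (nF V = 0 ↔ V = 0)
  nF_smul : ∀ (a : ℝ) (V), nF ((a : ℂ) • V) = |a| * nF V
  nF_add : ∀ V W, nF (V + W) ≤ nF V + nF W
  opOf : (𝓗 →L[ℂ] 𝓗) → SelfAdjointOperator 𝓗
  opOf_spec : ∀ V ∈ A0, IsSum (opOf 0) V (opOf V)
  comparable : ∀ V ∈ A0, ∀ W ∈ A0, ResolventComparable (opOf V) (opOf W)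
  nF_dominates : ∃ c : ℝ, 0 < c ∧ ∃ V₀ ∈ A0, ∃ z : ℂ, z.im ≠ 0 ∧
    ∀ V ∈ A0, c * traceNorm ((opOf V₀).resolvent z ∘L (V ∘L (opOf V₀).resolvent z)) ≤ nF V

/-- The infinitesimal spectral shift measure
`Φ_H(V)(φ) = Tr(E_H(supp φ) V φ(H))`, as a real number. -/
def PhiMeas {H : SelfAdjointOperator 𝓗} (E : SpectralMeasure H)
    (V : 𝓗 →L[ℂ] 𝓗) (φ : ℝ → ℝ) : ℝ :=
  (trace (E.proj (tsupport φ) ∘L (V ∘L E.fcR φ))).re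

/-- The absolutely continuous part of the infinitesimal spectral shift measure,
`Φ^{(a)}_H(V)(φ) = Tr(E^{(a)}_H(supp φ) V φ(H))`. -/
def PhiMeasAC {H : SelfAdjointOperator 𝓗} (E : SpectralMeasure H)
    (V : 𝓗 →L[ℂ] 𝓗) (φ : ℝ → ℝ) : ℝ :=
  (trace (E.acProj (tsupport φ) ∘L (V ∘L E.fcR φ))).re

/-- The singular part of the infinitesimal spectral shift measure,
`Φ^{(s)}_H(V)(φ) = Tr(E^{(s)}_H(supp φ) V φ(H))`. -/
def PhiMeasS {H : SelfAdjointOperator 𝓗} (E : SpectralMeasure H)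
    (V : 𝓗 →L[ℂ] 𝓗) (φ : ℝ → ℝ) : ℝ :=
  (trace (E.sProj (tsupport φ) ∘L (V ∘L E.fcR φ))).re

omit [CompleteSpace 𝓗] in
theorem mul_apply_eq (A B : 𝓗 →L[ℂ] 𝓗) (x : 𝓗) : (A * B) x = A (B x) := rfl

/-- `C` bounds all the sums `∑ |⟪e i, T (f i)⟫|` over finite orthonormal families. -/
def TraceBound (T : 𝓗 →L[ℂ] 𝓗) (C : ℝ) : Prop :=
  ∀ (n : ℕ) (e f : Fin n → 𝓗), Orthonormal ℂ e → Orthonormal ℂ f →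
    ∑ i, ‖⟪e i, T (f i)⟫_ℂ‖ ≤ C

namespace TraceBound

variable {S T : 𝓗 →L[ℂ] 𝓗} {C D : ℝ}

omit [CompleteSpace 𝓗] in
theorem nonneg (h : TraceBound T C) : 0 ≤ C := by
  simpa using h 0 Fin.elim0 Fin.elim0 ⟨fun i => i.elim0, fun i => i.elim0⟩
    ⟨fun i => i.elim0, fun i => i.elim0⟩

omit [CompleteSpace 𝓗] in
theorem mono (h : TraceBound T C) (hCD : C ≤ D) : TraceBound T D :=
  fun n e f he hf => (h n e f he hf).trans hCD

omit [CompleteSpace 𝓗] in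
theorem add (hS : TraceBound S C) (hT : TraceBound T D) : TraceBound (S + T) (C + D) := by
  intro n e f he hf
  refine le_trans ?_ (add_le_add (hS n e f he hf) (hT n e f he hf))
  rw [← Finset.sum_add_distrib]
  refine Finset.sum_le_sum fun i _ => ?_
  rw [add_apply, inner_add_right]
  exact norm_add_le _ _

omit [CompleteSpace 𝓗] in
theorem smul (c : ℂ) (hT : TraceBound T C) : TraceBound (c • T) (‖c‖ * C) := by
  intro n e f he hf
  simp only [smul_apply, inner_smul_right, norm_mul, ← Finset.mul_sum]
  exact mul_le_mul_of_nonneg_left (hT n e f he hf) (norm_nonneg c)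

omit [CompleteSpace 𝓗] in
theorem zero : TraceBound (0 : 𝓗 →L[ℂ] 𝓗) 0 := by
  intro n e f _ _
  simp

omit [CompleteSpace 𝓗] in
theorem sum {ι : Type*} (s : Finset ι) {S : ι → 𝓗 →L[ℂ] 𝓗} {C : ι → ℝ}
    (h : ∀ i ∈ s, TraceBound (S i) (C i)) : TraceBound (∑ i ∈ s, S i) (∑ i ∈ s, C i) := by
  classical
  induction s using Finset.induction_on with
  | empty => simpa using zero
  | insert a s ha ih =>
    rw [Finset.sum_insert ha, Finset.sum_insert ha]
    exact (h a (Finset.mem_insert_self a s)).add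
      (ih fun i hi => h i (Finset.mem_insert_of_mem hi))

theorem star (hT : TraceBound T C) : TraceBound (star T) C := by
  intro n e f he hf
  refine le_of_eq_of_le (Finset.sum_congr rfl fun i _ => ?_) (hT n f e hf he)
  rw [ContinuousLinearMap.star_eq_adjoint, ContinuousLinearMap.adjoint_inner_right,
    ← inner_conj_symm, RCLike.norm_conj]

theorem unitary_mul (u : unitary (𝓗 →L[ℂ] 𝓗)) (hT : TraceBound T C) :
    TraceBound ((u : 𝓗 →L[ℂ] 𝓗) * T) C := by
  intro n e f he hf
  have he' : Orthonormal ℂ fun i => (Star.star (u : 𝓗 →L[ℂ] 𝓗)) (e i) := by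
    rw [orthonormal_iff_ite] at he ⊢
    intro i j
    rw [← he i j, ContinuousLinearMap.star_eq_adjoint, ContinuousLinearMap.adjoint_inner_left,
      ← ContinuousLinearMap.star_eq_adjoint, ← mul_apply_eq,
      Unitary.mul_star_self_of_mem u.2, one_apply_eq_self]
  refine le_of_eq_of_le (Finset.sum_congr rfl fun i _ => ?_) (hT n _ f he' hf)
  rw [ContinuousLinearMap.star_eq_adjoint, ContinuousLinearMap.adjoint_inner_left,
    mul_apply_eq]

theorem mul_left (A : 𝓗 →L[ℂ] 𝓗) (hT : TraceBound T C) : TraceBound (A * T) (2 * ‖A‖ * C) := by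
  obtain ⟨u, c, hA, hc⟩ := CStarAlgebra.exists_sum_four_unitary A
  have key : TraceBound (A * T) (∑ i, ‖c i‖ * C) := by
    rw [hA, Finset.sum_mul]
    refine sum _ fun i _ => ?_
    rw [smul_mul_assoc]
    exact (hT.unitary_mul (u i)).smul (c i)
  refine key.mono ?_
  calc ∑ i, ‖c i‖ * C ≤ ∑ _i : Fin 4, ‖A‖ / 2 * C :=
        Finset.sum_le_sum fun i _ => mul_le_mul_of_nonneg_right (hc i) hT.nonneg
    _ = 2 * ‖A‖ * C := by
        rw [Finset.sum_const, Finset.card_univ, Fintype.card_fin, nsmul_eq_mul]; ring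

theorem mul_right (A : 𝓗 →L[ℂ] 𝓗) (hT : TraceBound T C) : TraceBound (T * A) (2 * ‖A‖ * C) := by
  simpa using (hT.star.mul_left (Star.star A)).star

omit [CompleteSpace 𝓗] in
theorem sum_le {ι : Type*} (h : TraceBound T C) {e f : ι → 𝓗} (he : Orthonormal ℂ e)
    (hf : Orthonormal ℂ f) (s : Finset ι) : ∑ i ∈ s, ‖⟪e i, T (f i)⟫_ℂ‖ ≤ C := by
  have hinj : Function.Injective fun j => (s.equivFin.symm j : ι) :=
    Subtype.val_injective.comp s.equivFin.symm.injective
  refine le_of_eq_of_le ?_ (h _ _ _ (he.comp _ hinj) (hf.comp _ hinj))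
  rw [← Finset.sum_coe_sort, ← s.equivFin.symm.sum_comp]
  rfl

omit [CompleteSpace 𝓗] in
theorem of_tendsto {S : ℕ → 𝓗 →L[ℂ] 𝓗} (h : ∀ n, TraceBound (S n) C)
    (hS : Tendsto S atTop (𝓝 T)) : TraceBound T C := by
  intro n e f he hf
  have : Tendsto (fun k => ∑ i, ‖⟪e i, S k (f i)⟫_ℂ‖) atTop
      (𝓝 (∑ i, ‖⟪e i, T (f i)⟫_ℂ‖)) := by
    refine tendsto_finsetSum _ fun i _ => (Tendsto.norm ?_)
    exact tendsto_const_nhds.inner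
      (((ContinuousLinearMap.apply ℂ 𝓗 (f i)).continuous.tendsto T).comp hS)
  exact le_of_tendsto' this fun k => h k n e f he hf

end TraceBound

/-- The index set of the Hilbert basis in which `trace` is computed. -/
abbrev BasisIndex (𝓗 : Type*) [NormedAddCommGroup 𝓗] [InnerProductSpace ℂ 𝓗] [CompleteSpace 𝓗] :
    Set 𝓗 := (exists_hilbertBasis ℂ 𝓗).choose

/-- The Hilbert basis in which `trace` is computed. -/
def basis (𝓗 : Type*) [NormedAddCommGroup 𝓗] [InnerProductSpace ℂ 𝓗] [CompleteSpace 𝓗] :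
    HilbertBasis (BasisIndex 𝓗) ℂ 𝓗 := (exists_hilbertBasis ℂ 𝓗).choose_spec.choose

theorem trace_eq_tsum (T : 𝓗 →L[ℂ] 𝓗) : trace T = ∑' i, ⟪basis 𝓗 i, T (basis 𝓗 i)⟫_ℂ := by
  have h : ⇑(basis 𝓗) = ((↑) : BasisIndex 𝓗 → 𝓗) :=
    (exists_hilbertBasis ℂ 𝓗).choose_spec.choose_spec
  simp only [trace, h]

section Trace

variable {S T : 𝓗 →L[ℂ] 𝓗} {C D : ℝ}

theorem TraceBound.summable_norm (hT : TraceBound T C) :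
    Summable fun i => ‖⟪basis 𝓗 i, T (basis 𝓗 i)⟫_ℂ‖ :=
  summable_of_sum_le (fun _ => norm_nonneg _)
    (hT.sum_le (basis 𝓗).orthonormal (basis 𝓗).orthonormal)

theorem TraceBound.tsum_norm_le (hT : TraceBound T C) :
    ∑' i, ‖⟪basis 𝓗 i, T (basis 𝓗 i)⟫_ℂ‖ ≤ C :=
  hT.summable_norm.tsum_le_of_sum_le
    (hT.sum_le (basis 𝓗).orthonormal (basis 𝓗).orthonormal)

theorem TraceBound.hasSum (hT : TraceBound T C) :
    HasSum (fun i => ⟪basis 𝓗 i, T (basis 𝓗 i)⟫_ℂ) (trace T) := by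
  rw [trace_eq_tsum]
  exact hT.summable_norm.of_norm.hasSum

theorem TraceBound.norm_trace_le (hT : TraceBound T C) : ‖trace T‖ ≤ C := by
  rw [trace_eq_tsum]
  exact (norm_tsum_le_tsum_norm hT.summable_norm).trans hT.tsum_norm_le

theorem trace_add (hS : TraceBound S C) (hT : TraceBound T D) :
    trace (S + T) = trace S + trace T := by
  rw [trace_eq_tsum]
  simpa [inner_add_right] using (hS.hasSum.add hT.hasSum).tsum_eq

theorem trace_smul (c : ℂ) (T : 𝓗 →L[ℂ] 𝓗) : trace (c • T) = c * trace T := by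
  simp [trace_eq_tsum, tsum_mul_left]

theorem trace_zero : trace (0 : 𝓗 →L[ℂ] 𝓗) = 0 := by
  simp [trace_eq_tsum]

theorem trace_sum {ι : Type*} (s : Finset ι) {S : ι → 𝓗 →L[ℂ] 𝓗} {C : ι → ℝ}
    (h : ∀ i ∈ s, TraceBound (S i) (C i)) : trace (∑ i ∈ s, S i) = ∑ i ∈ s, trace (S i) := by
  classical
  induction s using Finset.induction_on with
  | empty => simpa using trace_zero
  | insert a s ha ih =>
    rw [Finset.sum_insert ha, Finset.sum_insert ha,
      trace_add (h a (Finset.mem_insert_self a s))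
        (TraceBound.sum s fun i hi => h i (Finset.mem_insert_of_mem hi)),
      ih fun i hi => h i (Finset.mem_insert_of_mem hi)]

theorem trace_im_eq_zero (hT : IsSelfAdjoint T) : (trace T).im = 0 := by
  rw [← Complex.conj_eq_iff_im, trace_eq_tsum, Complex.conj_tsum]
  refine tsum_congr fun i => ?_
  rw [inner_conj_symm, ← ContinuousLinearMap.adjoint_inner_right,
    ← ContinuousLinearMap.star_eq_adjoint, hT.star_eq]

/-- A series of operators with summable trace bounds can be traced termwise. -/
theorem TraceBound.hasSum_series {ι : Type*} {S : ι → 𝓗 →L[ℂ] 𝓗} {B : ι → ℝ}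
    (hB : ∀ n, TraceBound (S n) (B n)) (hs : Summable B) (hS : HasSum S T) :
    TraceBound T (∑' n, B n) ∧ HasSum (fun n => trace (S n)) (trace T) := by
  have hB0 : ∀ n, 0 ≤ B n := fun n => (hB n).nonneg
  have happ : ∀ x y : 𝓗, HasSum (fun n => ⟪x, S n y⟫_ℂ) ⟪x, T y⟫_ℂ := fun x y =>
    (innerSL ℂ x).hasSum ((ContinuousLinearMap.apply ℂ 𝓗 y).hasSum hS)
  constructor
  · intro n e f he hf
    have hsum : ∀ i, Summable fun k => ‖⟪e i, S k (f i)⟫_ℂ‖ := fun i =>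
      (happ (e i) (f i)).summable.norm
    calc ∑ i, ‖⟪e i, T (f i)⟫_ℂ‖ ≤ ∑ i, ∑' k, ‖⟪e i, S k (f i)⟫_ℂ‖ := by
          refine Finset.sum_le_sum fun i _ => ?_
          rw [← (happ (e i) (f i)).tsum_eq]
          exact norm_tsum_le_tsum_norm (hsum i)
      _ = ∑' k, ∑ i, ‖⟪e i, S k (f i)⟫_ℂ‖ := (Summable.tsum_finsetSum fun i _ => hsum i).symm
      _ ≤ ∑' k, B k := (summable_sum fun i _ => hsum i).tsum_le_tsum
            (fun k => hB k n e f he hf) hs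
  · have hprod : Summable fun p : ι × BasisIndex 𝓗 => ⟪basis 𝓗 p.2, S p.1 (basis 𝓗 p.2)⟫_ℂ := by
      refine Summable.of_norm ?_
      rw [summable_prod_of_nonneg fun _ => norm_nonneg _]
      refine ⟨fun n => (hB n).summable_norm, ?_⟩
      exact hs.of_nonneg_of_le (fun n => tsum_nonneg fun _ => norm_nonneg _)
        fun n => (hB n).tsum_norm_le
    have h1 : trace T = ∑' p : ι × BasisIndex 𝓗, ⟪basis 𝓗 p.2, S p.1 (basis 𝓗 p.2)⟫_ℂ := by
      rw [← (Equiv.prodComm _ _).tsum_eq, trace_eq_tsum]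
      refine Eq.trans ?_ (Summable.tsum_prod ((Equiv.prodComm _ _).summable_iff.2 hprod)).symm
      exact tsum_congr fun i => (happ _ _).tsum_eq.symm
    rw [h1]
    exact hprod.hasSum.prod_fiberwise fun n => (hB n).hasSum

/-- Square summability of the matrix entries in the chosen basis. -/
def SummableEntries (X : 𝓗 →L[ℂ] 𝓗) : Prop :=
  Summable fun p : BasisIndex 𝓗 × BasisIndex 𝓗 => ‖⟪basis 𝓗 p.1, X (basis 𝓗 p.2)⟫_ℂ‖ ^ 2

theorem hasSum_norm_inner_basis_sq (y : 𝓗) :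
    HasSum (fun j => ‖⟪basis 𝓗 j, y⟫_ℂ‖ ^ 2) (‖y‖ ^ 2) := by
  have h := (basis 𝓗).hasSum_inner_mul_inner y y
  rw [inner_self_eq_norm_sq_to_K] at h
  rw [← Complex.hasSum_ofReal]
  have hj : ∀ j, ((‖⟪basis 𝓗 j, y⟫_ℂ‖ ^ 2 : ℝ) : ℂ) = ⟪y, basis 𝓗 j⟫_ℂ * ⟪basis 𝓗 j, y⟫_ℂ :=
    fun j => by
      rw [← inner_conj_symm y, Complex.conj_mul']
      norm_cast
  simp only [hj]
  exact_mod_cast h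

theorem summableEntries_iff {X : 𝓗 →L[ℂ] 𝓗} :
    SummableEntries X ↔ Summable fun i => ‖X (basis 𝓗 i)‖ ^ 2 := by
  have h1 : SummableEntries X ↔ Summable fun p : BasisIndex 𝓗 × BasisIndex 𝓗 =>
      ‖⟪basis 𝓗 p.2, X (basis 𝓗 p.1)⟫_ℂ‖ ^ 2 :=
    (Equiv.prodComm (BasisIndex 𝓗) (BasisIndex 𝓗)).summable_iff.symm
  have h2 : ∀ i, ∑' j, ‖⟪basis 𝓗 j, X (basis 𝓗 i)⟫_ℂ‖ ^ 2 = ‖X (basis 𝓗 i)‖ ^ 2 :=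
    fun i => (hasSum_norm_inner_basis_sq _).tsum_eq
  rw [h1, summable_prod_of_nonneg fun p => sq_nonneg _]
  simp only [h2]
  exact and_iff_right fun i => (hasSum_norm_inner_basis_sq _).summable

theorem SummableEntries.star {X : 𝓗 →L[ℂ] 𝓗} (h : SummableEntries X) :
    SummableEntries (star X) := by
  rw [SummableEntries, ← (Equiv.prodComm _ _).summable_iff]
  refine Summable.congr h fun p => ?_
  simp only [Function.comp, Equiv.prodComm_apply, Prod.fst_swap, Prod.snd_swap]
  rw [ContinuousLinearMap.star_eq_adjoint, ContinuousLinearMap.adjoint_inner_right,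
    ← inner_conj_symm, RCLike.norm_conj]

theorem SummableEntries.mul_left {X : 𝓗 →L[ℂ] 𝓗} (A : 𝓗 →L[ℂ] 𝓗) (h : SummableEntries X) :
    SummableEntries (A * X) := by
  rw [summableEntries_iff] at h ⊢
  refine (h.mul_left (‖A‖ ^ 2)).of_nonneg_of_le (fun _ => by positivity) fun i => ?_
  rw [← mul_pow]
  exact pow_le_pow_left₀ (norm_nonneg _) (A.le_opNorm _) 2

theorem SummableEntries.mul_right {X : 𝓗 →L[ℂ] 𝓗} (A : 𝓗 →L[ℂ] 𝓗) (h : SummableEntries X) :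
    SummableEntries (X * A) := by
  simpa using (h.star.mul_left (Star.star A)).star

theorem SummableEntries.trace_mul_comm {X Y : 𝓗 →L[ℂ] 𝓗} (hX : SummableEntries X)
    (hY : SummableEntries Y) : trace (X * Y) = trace (Y * X) := by
  have hexp : ∀ (X Y : 𝓗 →L[ℂ] 𝓗) (i : BasisIndex 𝓗),
      ∑' j, ⟪basis 𝓗 i, X (basis 𝓗 j)⟫_ℂ * ⟪basis 𝓗 j, Y (basis 𝓗 i)⟫_ℂ
        = ⟪basis 𝓗 i, (X * Y) (basis 𝓗 i)⟫_ℂ := fun X Y i => by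
    have := (basis 𝓗).tsum_inner_mul_inner (ContinuousLinearMap.adjoint X (basis 𝓗 i))
      (Y (basis 𝓗 i))
    simpa only [ContinuousLinearMap.adjoint_inner_left, mul_apply_eq] using this
  have hs : Summable fun p : BasisIndex 𝓗 × BasisIndex 𝓗 =>
      ⟪basis 𝓗 p.1, X (basis 𝓗 p.2)⟫_ℂ * ⟪basis 𝓗 p.2, Y (basis 𝓗 p.1)⟫_ℂ := by
    refine Summable.of_norm_bounded
      (Summable.add hX ((Equiv.prodComm _ _).summable_iff.2 hY)) fun p => ?_
    simp only [Function.comp, Equiv.prodComm_apply, Prod.fst_swap, Prod.snd_swap, norm_mul]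
    nlinarith [sq_nonneg (‖⟪basis 𝓗 p.1, X (basis 𝓗 p.2)⟫_ℂ‖
      - ‖⟪basis 𝓗 p.2, Y (basis 𝓗 p.1)⟫_ℂ‖), sq_nonneg (‖⟪basis 𝓗 p.1, X (basis 𝓗 p.2)⟫_ℂ‖
      + ‖⟪basis 𝓗 p.2, Y (basis 𝓗 p.1)⟫_ℂ‖)]
  rw [trace_eq_tsum, trace_eq_tsum]
  simp only [← hexp]
  rw [← hs.tsum_prod, ← (Equiv.prodComm _ _).tsum_eq]
  rw [← Summable.tsum_prod (f := fun p : BasisIndex 𝓗 × BasisIndex 𝓗 =>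
      ⟪basis 𝓗 p.1, Y (basis 𝓗 p.2)⟫_ℂ * ⟪basis 𝓗 p.2, X (basis 𝓗 p.1)⟫_ℂ)]
  · exact tsum_congr fun p => mul_comm _ _
  · exact ((Equiv.prodComm _ _).summable_iff.2 hs).congr fun p => mul_comm _ _

/-- The positive part of a self-adjoint trace class operator is the square of a
Hilbert-Schmidt operator. -/
theorem TraceBound.exists_sq_eq_posPart (hT : TraceBound T C) (hsa : IsSelfAdjoint T) :
    ∃ B : 𝓗 →L[ℂ] 𝓗, SummableEntries B ∧ B * B = cfc (fun t : ℝ => max t 0) T ∧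
      ∃ D, TraceBound (B * B) D := by
  have hBB : cfc (fun t : ℝ => √(max t 0)) T * cfc (fun t : ℝ => √(max t 0)) T
      = cfc (fun t : ℝ => max t 0) T := by
    rw [← cfc_mul (fun t : ℝ => √(max t 0)) (fun t : ℝ => √(max t 0)) T]
    exact cfc_congr fun t _ => Real.mul_self_sqrt (le_max_right t 0)
  have hBsa : IsSelfAdjoint (cfc (fun t : ℝ => √(max t 0)) T) := cfc_predicate _ _
  have hpos : TraceBound (cfc (fun t : ℝ => max t 0) T) (2 * C) := by
    have hcont : ∀ ε : ℝ, 0 < ε → Continuous fun t : ℝ => max t 0 / (|t| + ε) := fun ε hε =>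
      (continuous_id.max continuous_const).div (continuous_abs.add continuous_const)
        fun t => by positivity
    have hb : ∀ ε : ℝ, 0 < ε →
        TraceBound (cfc (fun t : ℝ => max t 0 / (|t| + ε)) T * T) (2 * C) := by
      intro ε hε
      refine (hT.mul_left _).mono ?_
      have : ‖cfc (fun t : ℝ => max t 0 / (|t| + ε)) T‖ ≤ 1 := by
        refine norm_cfc_le zero_le_one fun t _ => ?_
        rw [Real.norm_eq_abs, abs_div, abs_of_pos (by positivity : 0 < |t| + ε),
          div_le_one (by positivity), abs_of_nonneg (le_max_right t 0)]
        exact max_le (by linarith [le_abs_self t]) (by positivity)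
      nlinarith [hT.nonneg]
    have hclose : ∀ ε : ℝ, 0 < ε →
        ‖cfc (fun t : ℝ => max t 0 / (|t| + ε)) T * T - cfc (fun t : ℝ => max t 0) T‖ ≤ ε := by
      intro ε hε
      have h1 : cfc (fun t : ℝ => max t 0 / (|t| + ε)) T * T
          = cfc (fun t : ℝ => max t 0 / (|t| + ε) * t) T := by
        rw [cfc_mul (fun t : ℝ => max t 0 / (|t| + ε)) (fun t => t) T (hcont ε hε).continuousOn
          continuousOn_id, cfc_id' ℝ T]
      rw [h1, ← cfc_sub (fun t : ℝ => max t 0 / (|t| + ε) * t) (fun t => max t 0) T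
        ((hcont ε hε).mul continuous_id).continuousOn
        (continuous_id.max continuous_const).continuousOn]
      refine norm_cfc_le hε.le fun t _ => ?_
      rcases le_total t 0 with ht | ht
      · simp [max_eq_right ht, hε.le]
      · rw [max_eq_left ht, abs_of_nonneg ht, Real.norm_eq_abs]
        have : t / (t + ε) * t - t = -(t * ε / (t + ε)) := by field_simp; ring
        rw [this, abs_neg, abs_of_nonneg (by positivity), div_le_iff₀ (by positivity)]
        nlinarith
    refine TraceBound.of_tendsto (S := fun n : ℕ =>
      cfc (fun t : ℝ => max t 0 / (|t| + 1 / ((n : ℝ) + 1))) T * T)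
      (fun n => hb _ (by positivity)) ?_
    rw [tendsto_iff_norm_sub_tendsto_zero]
    exact squeeze_zero (fun _ => norm_nonneg _) (fun n => hclose _ (by positivity))
      tendsto_one_div_add_atTop_nhds_zero_nat
  refine ⟨_, ?_, hBB, _, hBB ▸ hpos⟩
  rw [summableEntries_iff]
  refine hpos.summable_norm.congr fun i => ?_
  rw [← hBB, mul_apply_eq, ← ContinuousLinearMap.adjoint_inner_left,
    ← ContinuousLinearMap.star_eq_adjoint, hBsa.star_eq, inner_self_eq_norm_sq_to_K]
  simp

theorem SummableEntries.trace_mul_sq_comm {B : 𝓗 →L[ℂ] 𝓗} (h : SummableEntries B)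
    (A : 𝓗 →L[ℂ] 𝓗) : trace (A * (B * B)) = trace (B * B * A) := by
  rw [← mul_assoc, (h.mul_left A).trace_mul_comm h, ← mul_assoc,
    (h.mul_right A).trace_mul_comm h, mul_assoc]

theorem TraceBound.trace_mul_comm_of_isSelfAdjoint (hT : TraceBound T C) (hsa : IsSelfAdjoint T)
    (A : 𝓗 →L[ℂ] 𝓗) : trace (A * T) = trace (T * A) := by
  obtain ⟨B, hB, hBT, D, hD⟩ := hT.exists_sq_eq_posPart hsa
  have hsa' : IsSelfAdjoint (-T) := hsa.neg
  obtain ⟨B', hB', hBT', D', hD'⟩ := TraceBound.exists_sq_eq_posPart (T := -T) (C := ‖(-1 : ℂ)‖ * C)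
    (by simpa using hT.smul (-1)) hsa'
  have hTdec : T = B * B + (-1 : ℂ) • (B' * B') := by
    have h1 : cfc (fun t : ℝ => max t 0) (-T) = cfc (fun t : ℝ => max (-t) 0) T :=
      (cfc_comp_neg (fun t : ℝ => max t 0) T).symm
    rw [hBT, hBT', h1, neg_smul, one_smul, ← sub_eq_add_neg,
      ← cfc_sub (fun t : ℝ => max t 0) (fun t => max (-t) 0) T]
    conv_lhs => rw [← cfc_id' ℝ T]
    refine cfc_congr fun t _ => ?_
    rcases le_total t 0 with ht | ht
    · simp [ht]
    · simp [ht]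
  rw [hTdec, mul_add, add_mul, trace_add (hD.mul_left A) (((hD'.smul (-1)).mul_left A)),
    trace_add (hD.mul_right A) (((hD'.smul (-1)).mul_right A)), mul_smul_comm, smul_mul_assoc,
    trace_smul, trace_smul, hB.trace_mul_sq_comm, hB'.trace_mul_sq_comm]

/-- Cyclicity of the trace. -/
theorem TraceBound.trace_mul_comm (hT : TraceBound T C) (A : 𝓗 →L[ℂ] 𝓗) :
    trace (A * T) = trace (T * A) := by
  have hre : TraceBound ((2⁻¹ : ℂ) • (T + Star.star T)) (‖(2⁻¹ : ℂ)‖ * (C + C)) :=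
    (hT.add hT.star).smul _
  have him : TraceBound ((2⁻¹ : ℂ) • (I • (T + (-1 : ℂ) • Star.star T)))
      (‖(2⁻¹ : ℂ)‖ * (‖I‖ * (C + ‖(-1 : ℂ)‖ * C))) :=
    ((hT.add (hT.star.smul (-1))).smul I).smul _
  have hresa : IsSelfAdjoint ((2⁻¹ : ℂ) • (T + Star.star T)) := by
    simp [IsSelfAdjoint, star_smul, add_comm]
  have himsa : IsSelfAdjoint ((2⁻¹ : ℂ) • (I • (T + (-1 : ℂ) • Star.star T))) := by
    simp only [IsSelfAdjoint, star_smul, star_add, star_star]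
    simp [smul_add, add_comm]
  have hdec : T = (2⁻¹ : ℂ) • (T + Star.star T)
      + (-I) • ((2⁻¹ : ℂ) • (I • (T + (-1 : ℂ) • Star.star T))) := by
    have : (-I) • ((2⁻¹ : ℂ) • (I • (T + (-1 : ℂ) • Star.star T)))
        = (2⁻¹ : ℂ) • (T + (-1 : ℂ) • Star.star T) := by
      rw [smul_smul, smul_smul]
      congr 1
      linear_combination (-(2⁻¹ : ℂ)) * I_mul_I
    rw [this]
    module
  have h1 := hre.trace_mul_comm_of_isSelfAdjoint hresa A
  have h2 := him.trace_mul_comm_of_isSelfAdjoint himsa A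
  rw [hdec, mul_add, add_mul, trace_add (hre.mul_left A) ((him.smul (-I)).mul_left A),
    trace_add (hre.mul_right A) ((him.smul (-I)).mul_right A), h1,
    mul_smul_comm (-I), smul_mul_assoc (-I), trace_smul, trace_smul, h2]

end Trace
omit [CompleteSpace 𝓗] in
theorem ext_inner_self {A B : 𝓗 →L[ℂ] 𝓗} (h : ∀ f, ⟪f, A f⟫_ℂ = ⟪f, B f⟫_ℂ) : A = B := by
  refine ContinuousLinearMap.coe_inj.1 ((ext_inner_map _ _).1 fun x => ?_)
  have := congrArg (starRingEnd ℂ) (h x)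
  rwa [inner_conj_symm, inner_conj_symm] at this

/-- Bounded Borel functions. -/
def IsBddBorel (φ : ℝ → ℂ) : Prop := Measurable φ ∧ ∃ C, ∀ x, ‖φ x‖ ≤ C

namespace IsBddBorel

variable {φ ψ : ℝ → ℂ}

theorem add (hφ : IsBddBorel φ) (hψ : IsBddBorel ψ) : IsBddBorel fun x => φ x + ψ x := by
  obtain ⟨hm, C, hC⟩ := hφ
  obtain ⟨hm', D, hD⟩ := hψ
  exact ⟨hm.add hm', C + D, fun x => (norm_add_le _ _).trans (add_le_add (hC x) (hD x))⟩

theorem const_mul (c : ℂ) (hφ : IsBddBorel φ) : IsBddBorel fun x => c * φ x := by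
  obtain ⟨hm, C, hC⟩ := hφ
  refine ⟨hm.const_mul c, ‖c‖ * C, fun x => ?_⟩
  rw [norm_mul]
  exact mul_le_mul_of_nonneg_left (hC x) (norm_nonneg c)

theorem mul (hφ : IsBddBorel φ) (hψ : IsBddBorel ψ) : IsBddBorel fun x => φ x * ψ x := by
  obtain ⟨hm, C, hC⟩ := hφ
  obtain ⟨hm', D, hD⟩ := hψ
  refine ⟨hm.mul hm', C * D, fun x => ?_⟩
  rw [norm_mul]
  exact mul_le_mul (hC x) (hD x) (norm_nonneg _) ((norm_nonneg _).trans (hC x))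

theorem conj (hφ : IsBddBorel φ) : IsBddBorel fun x => starRingEnd ℂ (φ x) := by
  obtain ⟨hm, C, hC⟩ := hφ
  exact ⟨Complex.continuous_conj.measurable.comp hm, C,
    fun x => (RCLike.norm_conj _).trans_le (hC x)⟩

theorem indicator (hφ : IsBddBorel φ) {s : Set ℝ} (hs : MeasurableSet s) :
    IsBddBorel (s.indicator φ) := by
  obtain ⟨hm, C, hC⟩ := hφ
  exact ⟨hm.indicator hs, C, fun x => (norm_indicator_le_norm_self φ x).trans (hC x)⟩

theorem const (c : ℂ) : IsBddBorel fun _ => c := ⟨measurable_const, ‖c‖, fun _ => le_rfl⟩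

theorem integrable (hφ : IsBddBorel φ) (μ : Measure ℝ) [IsFiniteMeasure μ] : Integrable φ μ := by
  obtain ⟨hm, C, hC⟩ := hφ
  exact Integrable.of_bound hm.aestronglyMeasurable C (Eventually.of_forall hC)

theorem of_simpleFunc (ψ : SimpleFunc ℝ ℂ) : IsBddBorel ψ :=
  ⟨ψ.measurable, ψ.exists_forall_norm_le⟩

end IsBddBorel

namespace SpectralMeasure

variable {H : SelfAdjointOperator 𝓗} (E : SpectralMeasure H) {φ ψ : ℝ → ℂ} {s : Set ℝ}

instance (f : 𝓗) : IsFiniteMeasure (E.scalar f) := E.scalar_finite f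

theorem inner_fc (hφ : IsBddBorel φ) (f : 𝓗) : ⟪f, E.fc φ f⟫_ℂ = ∫ x, φ x ∂(E.scalar f) :=
  E.fc_spec φ hφ.1 hφ.2 f

theorem measureReal_scalar_univ (f : 𝓗) : (E.scalar f).real univ = ‖f‖ ^ 2 := by
  rw [Measure.real, E.scalar_spec f univ MeasurableSet.univ, E.proj_univ, one_apply_eq_self,
    inner_self_eq_norm_sq_to_K]
  norm_cast

theorem fc_add (hφ : IsBddBorel φ) (hψ : IsBddBorel ψ) :
    E.fc (fun x => φ x + ψ x) = E.fc φ + E.fc ψ := by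
  refine ext_inner_self fun f => ?_
  rw [E.inner_fc (hφ.add hψ), add_apply, inner_add_right, E.inner_fc hφ,
    E.inner_fc hψ, integral_add (hφ.integrable _) (hψ.integrable _)]

theorem fc_const_mul (c : ℂ) (hφ : IsBddBorel φ) : E.fc (fun x => c * φ x) = c • E.fc φ := by
  refine ext_inner_self fun f => ?_
  rw [E.inner_fc (hφ.const_mul c), smul_apply, inner_smul_right, E.inner_fc hφ,
    integral_const_mul]

theorem fc_one : E.fc (fun _ => 1) = 1 := by
  refine ext_inner_self fun f => ?_
  rw [E.inner_fc (IsBddBorel.const 1), integral_const, E.measureReal_scalar_univ,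
    one_apply_eq_self, inner_self_eq_norm_sq_to_K]
  simp

theorem fc_conj (hφ : IsBddBorel φ) : E.fc (fun x => starRingEnd ℂ (φ x)) = star (E.fc φ) := by
  refine ext_inner_self fun f => ?_
  rw [E.inner_fc hφ.conj, ContinuousLinearMap.star_eq_adjoint,
    ContinuousLinearMap.adjoint_inner_right, ← inner_conj_symm, E.inner_fc hφ, integral_conj]

theorem resolvent_eq_fc {z : ℂ} (hz : z.im ≠ 0) :
    H.resolvent z = E.fc fun x => ((x : ℂ) - z)⁻¹ := by
  refine ext_inner_self fun f => ?_
  rw [E.resolvent_spec z hz]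
  refine (E.inner_fc ⟨by fun_prop, |z.im|⁻¹, fun x => ?_⟩ f).symm
  rw [norm_inv]
  refine inv_anti₀ (abs_pos.2 hz) ?_
  simpa using Complex.abs_im_le_norm ((x : ℂ) - z)

theorem inner_proj_self (f : 𝓗) (hs : MeasurableSet s) :
    ⟪f, E.proj s f⟫_ℂ = ((E.scalar f).real s : ℂ) := by
  rw [Measure.real, E.scalar_spec f s hs]
  refine (Complex.conj_eq_iff_re.1 ?_).symm
  rw [inner_conj_symm, ← ContinuousLinearMap.adjoint_inner_right,
    ← ContinuousLinearMap.star_eq_adjoint, (E.proj_sa s).star_eq]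

theorem fc_indicator_one (hs : MeasurableSet s) : E.fc (s.indicator fun _ => 1) = E.proj s := by
  refine ext_inner_self fun f => ?_
  rw [E.inner_fc ((IsBddBorel.const 1).indicator hs), E.inner_proj_self f hs,
    integral_indicator_const _ hs]
  simp

theorem proj_mul_proj (s t : Set ℝ) : E.proj s * E.proj t = E.proj (s ∩ t) := (E.proj_mul s t).symm

theorem proj_empty : E.proj ∅ = 0 := by
  refine ext_inner_self fun f => ?_
  rw [E.inner_proj_self f MeasurableSet.empty]
  simp

theorem inner_proj_comm (f g : 𝓗) : ⟪E.proj s f, g⟫_ℂ = ⟪f, E.proj s g⟫_ℂ := by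
  rw [← ContinuousLinearMap.adjoint_inner_right, ← ContinuousLinearMap.star_eq_adjoint,
    (E.proj_sa s).star_eq]

theorem scalar_proj (f : 𝓗) (hs : MeasurableSet s) :
    E.scalar (E.proj s f) = (E.scalar f).restrict s := by
  refine Measure.ext fun t ht => ?_
  rw [← ENNReal.toReal_eq_toReal_iff' (measure_ne_top _ _) (measure_ne_top _ _),
    Measure.restrict_apply ht, E.scalar_spec _ t ht, E.scalar_spec f _ (ht.inter hs),
    inner_proj_comm, ← mul_apply_eq, ← mul_apply_eq, proj_mul_proj, proj_mul_proj,
    inter_comm t s, inter_comm (s ∩ t) s, ← inter_assoc, inter_self]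

theorem proj_mul_fc_mul_proj (hφ : IsBddBorel φ) (hs : MeasurableSet s) :
    E.proj s * E.fc φ * E.proj s = E.fc (s.indicator φ) := by
  refine ext_inner_self fun f => ?_
  rw [mul_apply_eq, mul_apply_eq, ← inner_proj_comm, E.inner_fc hφ, E.scalar_proj f hs,
    E.inner_fc (hφ.indicator hs), integral_indicator hs]

theorem fc_mul_proj (hφ : IsBddBorel φ) (hs : MeasurableSet s) :
    E.fc φ * E.proj s = E.fc (s.indicator φ) := by
  have h : E.fc φ = E.proj s * E.fc φ * E.proj s + E.proj sᶜ * E.fc φ * E.proj sᶜ := by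
    rw [E.proj_mul_fc_mul_proj hφ hs, E.proj_mul_fc_mul_proj hφ hs.compl,
      ← E.fc_add (hφ.indicator hs) (hφ.indicator hs.compl)]
    congr 1
    ext x
    exact (congrFun (indicator_self_add_compl s φ) x).symm
  rw [← E.proj_mul_fc_mul_proj hφ hs]
  conv_lhs => rw [h]
  rw [add_mul, mul_assoc _ (E.proj s) (E.proj s), mul_assoc _ (E.proj sᶜ) (E.proj s),
    proj_mul_proj, proj_mul_proj, compl_inter_self, proj_empty, inter_self, mul_zero, add_zero]

theorem fc_mul_simpleFunc (hφ : IsBddBorel φ) (ψ : SimpleFunc ℝ ℂ) :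
    E.fc φ * E.fc ψ = E.fc fun x => φ x * ψ x := by
  induction ψ using SimpleFunc.induction with
  | const c hs =>
    rename_i s
    have h1 : ⇑(SimpleFunc.piecewise s hs (SimpleFunc.const ℝ c) (SimpleFunc.const ℝ 0))
        = fun x => c * s.indicator (fun _ => 1) x := by
      ext x
      by_cases hx : x ∈ s <;> simp [hx]
    have h2 : (fun x => φ x * (c * s.indicator (fun _ => 1) x)) = fun x => c * s.indicator φ x := by
      ext x
      by_cases hx : x ∈ s <;> simp [hx, mul_comm]
    rw [h1, h2, E.fc_const_mul c ((IsBddBorel.const 1).indicator hs), E.fc_indicator_one hs,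
      E.fc_const_mul c (hφ.indicator hs), mul_smul_comm, E.fc_mul_proj hφ hs]
  | @add f g _ hf hg =>
    have h1 : (fun x => φ x * (f + g) x) = fun x => φ x * f x + φ x * g x := by
      ext x
      simp [mul_add]
    have h2 : ⇑(f + g) = fun x => f x + g x := rfl
    rw [h1, h2, E.fc_add (.of_simpleFunc f) (.of_simpleFunc g), mul_add, hf, hg,
      E.fc_add (hφ.mul (.of_simpleFunc f)) (hφ.mul (.of_simpleFunc g))]

theorem tendsto_inner_fc {ψ : ℕ → ℝ → ℂ} {C : ℝ} (hψ : ∀ n, Measurable (ψ n))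
    (hC : ∀ n x, ‖ψ n x‖ ≤ C) (hφ : IsBddBorel φ)
    (hlim : ∀ x, Tendsto (fun n => ψ n x) atTop (𝓝 (φ x))) (f g : 𝓗) :
    Tendsto (fun n => ⟪g, E.fc (ψ n) f⟫_ℂ) atTop (𝓝 ⟪g, E.fc φ f⟫_ℂ) := by
  have hq : ∀ h : 𝓗, Tendsto (fun n => ⟪E.fc (ψ n) h, h⟫_ℂ) atTop (𝓝 ⟪E.fc φ h, h⟫_ℂ) := by
    intro h
    have h1 : Tendsto (fun n => ⟪h, E.fc (ψ n) h⟫_ℂ) atTop (𝓝 ⟪h, E.fc φ h⟫_ℂ) := by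
      rw [E.inner_fc hφ]
      simp only [fun n => E.inner_fc ⟨hψ n, C, hC n⟩ h]
      exact tendsto_integral_of_dominated_convergence (fun _ => C)
        (fun n => (hψ n).aestronglyMeasurable) (integrable_const C)
        (fun n => Eventually.of_forall (hC n)) (Eventually.of_forall hlim)
    simpa only [Function.comp_def, inner_conj_symm] using
      (Complex.continuous_conj.tendsto _).comp h1
  have h2 : Tendsto (fun n => ⟪E.fc (ψ n) f, g⟫_ℂ) atTop (𝓝 ⟪E.fc φ f, g⟫_ℂ) := by
    have hp : ∀ T : 𝓗 →L[ℂ] 𝓗, ⟪T f, g⟫_ℂ = _ := fun T =>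
      inner_map_polarization (T : 𝓗 →ₗ[ℂ] 𝓗) g f
    simp only [hp]
    exact (((((hq _).sub (hq _)).add ((hq _).const_mul I)).sub ((hq _).const_mul I))).div_const 4
  simpa only [Function.comp_def, inner_conj_symm] using
    (Complex.continuous_conj.tendsto _).comp h2

theorem fc_mul (hφ : IsBddBorel φ) (hψ : IsBddBorel ψ) :
    E.fc φ * E.fc ψ = E.fc fun x => φ x * ψ x := by
  obtain ⟨Cφ, hCφ⟩ := hφ.2
  obtain ⟨C, hC⟩ := hψ.2
  have hC0 : 0 ≤ C := (norm_nonneg _).trans (hC 0)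
  have hsm : StronglyMeasurable ψ := hψ.1.stronglyMeasurable
  have hb := fun n x => hsm.norm_approxBounded_le (c := C) hC0 n x
  have hlim := fun x => hsm.tendsto_approxBounded_of_norm_le (hC x)
  refine ext_inner_self fun f => ?_
  have h1 : Tendsto (fun n => ⟪f, (E.fc φ * E.fc (hsm.approxBounded C n)) f⟫_ℂ) atTop
      (𝓝 ⟪f, (E.fc φ * E.fc ψ) f⟫_ℂ) := by
    simp only [mul_apply_eq, ← ContinuousLinearMap.adjoint_inner_left (E.fc φ)]
    exact E.tendsto_inner_fc (fun n => (hsm.approxBounded C n).measurable) hb hψ hlim f _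
  refine tendsto_nhds_unique h1 ?_
  simp only [E.fc_mul_simpleFunc hφ]
  refine E.tendsto_inner_fc (C := Cφ * C)
    (fun n => hφ.1.mul (hsm.approxBounded C n).measurable) (fun n x => ?_) (hφ.mul hψ)
    (fun x => (hlim x).const_mul _) f f
  rw [Pi.mul_apply, norm_mul]
  exact mul_le_mul (hCφ x) (hb n x) (norm_nonneg _) ((norm_nonneg _).trans (hCφ x))

theorem norm_fc_le {C : ℝ} (hφ : Measurable φ) (hC : ∀ x, ‖φ x‖ ≤ C) : ‖E.fc φ‖ ≤ C := by
  have hC0 : 0 ≤ C := (norm_nonneg _).trans (hC 0)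
  have hb : IsBddBorel φ := ⟨hφ, C, hC⟩
  refine ContinuousLinearMap.opNorm_le_bound _ hC0 fun f => ?_
  have h1 : ((‖E.fc φ f‖ ^ 2 : ℝ) : ℂ) = ∫ x, starRingEnd ℂ (φ x) * φ x ∂(E.scalar f) := by
    rw [← E.inner_fc (hb.conj.mul hb), ← E.fc_mul hb.conj hb, mul_apply_eq, E.fc_conj hb,
      ContinuousLinearMap.star_eq_adjoint, ContinuousLinearMap.adjoint_inner_right,
      inner_self_eq_norm_sq_to_K]
    norm_cast
  have h2 : ‖E.fc φ f‖ ^ 2 ≤ C ^ 2 * ‖f‖ ^ 2 := by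
    have h3 : ‖∫ x, starRingEnd ℂ (φ x) * φ x ∂(E.scalar f)‖
        ≤ C ^ 2 * (E.scalar f).real univ := by
      refine norm_integral_le_of_norm_le_const (Eventually.of_forall fun x => ?_)
      rw [norm_mul, RCLike.norm_conj, ← sq]
      exact pow_le_pow_left₀ (norm_nonneg _) (hC x) 2
    rwa [← h1, E.measureReal_scalar_univ, Complex.norm_real, Real.norm_eq_abs,
      abs_of_nonneg (by positivity)] at h3
  rw [← mul_pow] at h2
  exact le_of_sq_le_sq h2 (by positivity)

/-- Uniformly absolutely convergent series pass through the functional calculus. -/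
theorem hasSum_fc {ι : Type*} [Countable ι] {ψ : ι → ℝ → ℂ} {B : ι → ℝ} (hm : ∀ n, Measurable (ψ n))
    (hB : ∀ n x, ‖ψ n x‖ ≤ B n) (hs : Summable B) (hφ : IsBddBorel φ)
    (hsum : ∀ x, HasSum (fun n => ψ n x) (φ x)) :
    HasSum (fun n => E.fc (ψ n)) (E.fc φ) := by
  have hsn : Summable fun n => E.fc (ψ n) :=
    Summable.of_norm_bounded hs fun n => E.norm_fc_le (hm n) (hB n)
  convert hsn.hasSum
  refine ext_inner_self fun f => ?_
  have h1 : HasSum (fun n => ⟪f, E.fc (ψ n) f⟫_ℂ) ⟪f, (∑' n, E.fc (ψ n)) f⟫_ℂ :=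
    (innerSL ℂ f).hasSum ((ContinuousLinearMap.apply ℂ 𝓗 f).hasSum hsn.hasSum)
  refine HasSum.unique ?_ h1
  simp only [fun n => E.inner_fc ⟨hm n, B n, hB n⟩ f]
  rw [E.inner_fc hφ]
  exact hasSum_integral_of_dominated_convergence (fun n _ => B n)
    (fun n => (hm n).aestronglyMeasurable) (fun n => Eventually.of_forall (hB n))
    (Eventually.of_forall fun _ => hs) (integrable_const _) (Eventually.of_forall hsum)

end SpectralMeasure

section TracePath

variable {T : 𝓗 →L[ℂ] 𝓗} {C : ℝ}

/-- The bounded linear functional `A ↦ Tr (A T)` associated with a trace class operator `T`. -/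
def TraceBound.functional (hT : TraceBound T C) : (𝓗 →L[ℂ] 𝓗) →L[ℂ] ℂ :=
  LinearMap.mkContinuous
    { toFun := fun A => trace (A * T)
      map_add' := fun A B => by rw [add_mul, trace_add (hT.mul_left A) (hT.mul_left B)]
      map_smul' := fun c A => by rw [smul_mul_assoc, trace_smul]; rfl }
    (2 * C) fun A => (hT.mul_left A).norm_trace_le.trans_eq (by ring)

theorem TraceBound.trace_mul_mul (hT : TraceBound T C) (A B : 𝓗 →L[ℂ] 𝓗) :
    trace (A * T * B) = hT.functional (B * A) := by
  rw [← (hT.mul_left A).trace_mul_comm B, ← mul_assoc]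
  rfl

theorem TraceBound.mul_mul (hT : TraceBound T C) {A B : 𝓗 →L[ℂ] 𝓗} {a b : ℝ} (hA : ‖A‖ ≤ a)
    (hB : ‖B‖ ≤ b) : TraceBound (A * T * B) (4 * a * b * C) := by
  refine ((hT.mul_left A).mul_right B).mono ?_
  have hC := hT.nonneg
  have ha := (norm_nonneg A).trans hA
  calc 2 * ‖B‖ * (2 * ‖A‖ * C) = 4 * (‖A‖ * ‖B‖) * C := by ring
    _ ≤ 4 * (a * b) * C := by gcongr
    _ = 4 * a * b * C := by ring

theorem pow_sub_pow_eq_sum {R : Type*} [Ring R] (a b : R) (n : ℕ) :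
    a ^ n - b ^ n = ∑ k ∈ Finset.range n, a ^ k * (a - b) * b ^ (n - 1 - k) := by
  induction n with
  | zero => simp
  | succ n ih =>
    have h : a ^ (n + 1) - b ^ (n + 1) = a * (a ^ n - b ^ n) + (a - b) * b ^ n := by
      rw [pow_succ', pow_succ']
      noncomm_ring
    rw [h, ih, Finset.sum_range_succ', Finset.mul_sum]
    congr 1
    · refine Finset.sum_congr rfl fun k hk => ?_
      rw [pow_succ', show n + 1 - 1 - (k + 1) = n - 1 - k by omega]
      simp only [mul_assoc]
    · simp

variable {A X Y : ℝ → 𝓗 →L[ℂ] 𝓗} {c : ℂ}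

omit [CompleteSpace 𝓗] in
theorem pow_sub_pow_of_sub_eq
    (hsub : ∀ s r, A s - A r = (c * (s - r : ℝ)) • (X s * T * Y r)) (n : ℕ) (s r : ℝ) :
    A s ^ n - A r ^ n = (c * (s - r : ℝ)) •
      ∑ k ∈ Finset.range n, (A s ^ k * X s) * T * (Y r * A r ^ (n - 1 - k)) := by
  rw [pow_sub_pow_eq_sum, Finset.smul_sum]
  refine Finset.sum_congr rfl fun k _ => ?_
  rw [hsub, mul_smul_comm, smul_mul_assoc]
  simp only [mul_assoc]

/-- The differences of powers grow at most linearly in trace norm. -/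
theorem TraceBound.pow_sub_pow (hT : TraceBound T C)
    (hsub : ∀ s r, A s - A r = (c * (s - r : ℝ)) • (X s * T * Y r))
    (hA : ∀ s, ‖A s‖ ≤ 1) (n : ℕ) (s r : ℝ) :
    TraceBound (A s ^ n - A r ^ n)
      (n * (‖c * (s - r : ℝ)‖ * (4 * ‖X s‖ * ‖Y r‖ * C))) := by
  have hpow : ∀ s k, ‖A s ^ k‖ ≤ 1 := fun s k => by
    induction k with
    | zero => exact ContinuousLinearMap.norm_id_le
    | succ k ih =>
      rw [pow_succ]
      exact (norm_mul_le _ _).trans (mul_le_one₀ ih (norm_nonneg _) (hA s))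
  rw [pow_sub_pow_of_sub_eq hsub]
  have h := TraceBound.sum (Finset.range n)
    (S := fun k => (A s ^ k * X s) * T * (Y r * A r ^ (n - 1 - k)))
    (C := fun _ => 4 * ‖X s‖ * ‖Y r‖ * C) fun k _ => hT.mul_mul
      ((norm_mul_le _ _).trans (mul_le_of_le_one_left (norm_nonneg _) (hpow s k)))
      ((norm_mul_le _ _).trans (mul_le_of_le_one_right (norm_nonneg _) (hpow r _)))
  refine (h.smul _).mono (le_of_eq ?_)
  rw [Finset.sum_const, Finset.card_range, nsmul_eq_mul]
  ring

/-- The derivative of the trace of a power along a path with trace class increments. -/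
theorem TraceBound.hasDerivAt_trace_pow_sub (hT : TraceBound T C)
    (hsub : ∀ s r, A s - A r = (c * (s - r : ℝ)) • (X s * T * Y r))
    (hA : ∀ s, ‖A s‖ ≤ 1) (hAc : Continuous A) (hXc : Continuous X) (n : ℕ) (r : ℝ) :
    HasDerivAt (fun s => trace (A s ^ n - A 0 ^ n))
      (n * c * hT.functional (Y r * A r ^ (n - 1) * X r)) r := by
  have hincr : ∀ s, trace (A s ^ n - A 0 ^ n) - trace (A r ^ n - A 0 ^ n) =
      (c * (s - r : ℝ)) * ∑ k ∈ Finset.range n,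
        hT.functional (Y r * A r ^ (n - 1 - k) * (A s ^ k * X s)) := fun s => by
    have h1 : A s ^ n - A 0 ^ n = (A s ^ n - A r ^ n) + (A r ^ n - A 0 ^ n) := by abel
    rw [h1, trace_add (hT.pow_sub_pow hsub hA n s r) (hT.pow_sub_pow hsub hA n r 0),
      add_sub_cancel_right, pow_sub_pow_of_sub_eq hsub, trace_smul,
      trace_sum _ fun k _ => hT.mul_mul (le_refl ‖A s ^ k * X s‖)
        (le_refl ‖Y r * A r ^ (n - 1 - k)‖)]
    simp only [hT.trace_mul_mul]
  rw [hasDerivAt_iff_tendsto_slope]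
  have hcont : Continuous fun s => c * ∑ k ∈ Finset.range n,
      hT.functional (Y r * A r ^ (n - 1 - k) * (A s ^ k * X s)) := by fun_prop
  have hval : n * c * hT.functional (Y r * A r ^ (n - 1) * X r) = c * ∑ k ∈ Finset.range n,
      hT.functional (Y r * A r ^ (n - 1 - k) * (A r ^ k * X r)) := by
    have : ∀ k ∈ Finset.range n, hT.functional (Y r * A r ^ (n - 1 - k) * (A r ^ k * X r))
        = hT.functional (Y r * A r ^ (n - 1) * X r) := fun k hk => by
      rw [Finset.mem_range] at hk
      rw [show n - 1 = (n - 1 - k) + k by omega, pow_add]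
      simp only [mul_assoc, Nat.add_sub_cancel]
    rw [Finset.sum_congr rfl this, Finset.sum_const, Finset.card_range, nsmul_eq_mul]
    ring
  rw [hval]
  refine ((hcont.tendsto r).mono_left nhdsWithin_le_nhds).congr' ?_
  filter_upwards [self_mem_nhdsWithin] with s hs
  have hs' : ((s - r : ℝ) : ℂ) ≠ 0 := Complex.ofReal_ne_zero.2 (sub_ne_zero.2 hs)
  rw [slope_def_module, hincr, Complex.real_smul, Complex.ofReal_inv]
  field_simp

theorem TraceBound.trace_pow_sub_pow (hT : TraceBound T C)
    (hsub : ∀ s r, A s - A r = (c * (s - r : ℝ)) • (X s * T * Y r))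
    (hA : ∀ s, ‖A s‖ ≤ 1) (hAc : Continuous A) (hXc : Continuous X) (hYc : Continuous Y) (n : ℕ) :
    trace (A 1 ^ n - A 0 ^ n) =
      ∫ r in (0 : ℝ)..1, n * c * hT.functional (Y r * A r ^ (n - 1) * X r) := by
  rw [intervalIntegral.integral_eq_sub_of_hasDerivAt
    (fun r _ => hT.hasDerivAt_trace_pow_sub hsub hA hAc hXc n r)
    (Continuous.intervalIntegrable (by fun_prop) 0 1), sub_self, trace_zero, sub_zero]

end TracePath

section Resolvent

variable {H : SelfAdjointOperator 𝓗}

theorem isBddBorel_resolvent {z : ℂ} (hz : z.im ≠ 0) : IsBddBorel fun x => ((x : ℂ) - z)⁻¹ := by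
  refine ⟨by fun_prop, |z.im|⁻¹, fun x => ?_⟩
  rw [norm_inv]
  refine inv_anti₀ (abs_pos.2 hz) ?_
  simpa using Complex.abs_im_le_norm ((x : ℂ) - z)

theorem ofReal_sub_ne_zero {z : ℂ} (hz : z.im ≠ 0) (x : ℝ) : (x : ℂ) - z ≠ 0 := fun h => hz <| by
  simpa using congrArg Complex.im h

theorem SpectralMeasure.star_resolvent (E : SpectralMeasure H) {z : ℂ} (hz : z.im ≠ 0) :
    star (H.resolvent z) = H.resolvent (starRingEnd ℂ z) := by
  rw [E.resolvent_eq_fc hz, ← E.fc_conj (isBddBorel_resolvent hz),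
    E.resolvent_eq_fc (by simpa using hz)]
  simp

/-- The first resolvent identity, in factored form. -/
theorem SpectralMeasure.resolvent_eq_mul (E : SpectralMeasure H) {z w : ℂ} (hz : z.im ≠ 0)
    (hw : w.im ≠ 0) :
    H.resolvent w = (1 + (w - z) • H.resolvent w) * H.resolvent z := by
  have hb := (isBddBorel_resolvent hw).const_mul (w - z)
  rw [E.resolvent_eq_fc hz, E.resolvent_eq_fc hw, ← E.fc_one, ← E.fc_const_mul _
    (isBddBorel_resolvent hw), ← E.fc_add (.const 1) hb,
    E.fc_mul ((IsBddBorel.const 1).add hb) (isBddBorel_resolvent hz)]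
  congr 1
  ext x
  have h1 := ofReal_sub_ne_zero hz x
  have h2 := ofReal_sub_ne_zero hw x
  field_simp
  ring

theorem SpectralMeasure.resolvent_eq_mul' (E : SpectralMeasure H) {z w : ℂ} (hz : z.im ≠ 0)
    (hw : w.im ≠ 0) :
    H.resolvent w = H.resolvent z * (1 + (w - z) • H.resolvent w) := by
  have h := E.resolvent_eq_mul (z := starRingEnd ℂ z) (w := starRingEnd ℂ w) (by simpa using hz)
    (by simpa using hw)
  have h' := congrArg star h
  rw [star_mul, star_add, star_one, star_smul, E.star_resolvent (by simpa using hw),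
    E.star_resolvent (by simpa using hz)] at h'
  simpa using h'

end Resolvent

namespace AffineSetting

variable (𝒜 : AffineSetting 𝓗) (E : ∀ V : 𝓗 →L[ℂ] 𝓗, SpectralMeasure (𝒜.opOf V))
  {V W : 𝓗 →L[ℂ] 𝓗}

include E

/-- The second resolvent identity between two operators of the affine space. -/
theorem resolvent_sub_resolvent (hV : V ∈ 𝒜.A0) (hW : W ∈ 𝒜.A0) {z : ℂ} (hz : z.im ≠ 0) :
    (𝒜.opOf V).resolvent z - (𝒜.opOf W).resolvent z =
      -((𝒜.opOf W).resolvent z * (V - W) * (𝒜.opOf V).resolvent z) := by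
  have hW' := 𝒜.opOf_spec W hW z hz
  have hV' : (𝒜.opOf V).resolvent z - (𝒜.opOf 0).resolvent z =
      -((𝒜.opOf 0).resolvent z * (V * (𝒜.opOf V).resolvent z)) := by
    have hz' : (starRingEnd ℂ z).im ≠ 0 := by simpa using hz
    have h : star _ = star _ := congrArg star (𝒜.opOf_spec V hV (starRingEnd ℂ z) hz')
    change _ = star (-((𝒜.opOf V).resolvent _ * (V * (𝒜.opOf 0).resolvent _))) at h
    rwa [star_sub, star_neg, star_mul, star_mul, (E V).star_resolvent hz',
      (E 0).star_resolvent hz', Complex.conj_conj, (𝒜.sa_mem V hV).star_eq, mul_assoc] at h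
  change _ = -((𝒜.opOf W).resolvent z * (W * (𝒜.opOf 0).resolvent z)) at hW'
  set P := (𝒜.opOf V).resolvent z
  set Q := (𝒜.opOf W).resolvent z
  set R := (𝒜.opOf 0).resolvent z
  have hQ : Q * (W * R) = R - Q := by rw [← neg_sub, hW', neg_neg]
  have hRVP : R * (V * P) = R - P := by rw [← neg_sub, hV', neg_neg]
  have hP : P = R - R * (V * P) := by rw [hRVP, sub_sub_cancel]
  have key : Q * W * P = (R - Q) - (R - Q) * (V * P) := by
    calc Q * W * P = Q * W * (R - R * (V * P)) := by rw [← hP]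
      _ = Q * (W * R) - Q * (W * R) * (V * P) := by noncomm_ring
      _ = _ := by rw [hQ]
  rw [mul_sub, sub_mul, key, sub_mul, hRVP]
  noncomm_ring

theorem exists_traceBound (hV : V ∈ 𝒜.A0) (hW : W ∈ 𝒜.A0) {z : ℂ} (hz : z.im ≠ 0) :
    ∃ C, TraceBound ((𝒜.opOf W).resolvent z * (V - W) * (𝒜.opOf W).resolvent z) C := by
  obtain ⟨w, hw, C, hC⟩ := 𝒜.comparable V hV W hW
  change TraceBound _ C at hC
  rw [𝒜.resolvent_sub_resolvent E hW hV hw] at hC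
  have hW1 := (E W).resolvent_eq_mul' hw hz
  have hV1 := (E V).resolvent_eq_mul hw hz
  have hW2 := 𝒜.resolvent_sub_resolvent E hV hW hz
  have hW3 : (𝒜.opOf W).resolvent z =
      (1 + (𝒜.opOf W).resolvent z * (V - W)) * (𝒜.opOf V).resolvent z := by
    rw [add_mul, one_mul, ← neg_eq_iff_eq_neg.2 hW2]
    abel
  set QW := 1 + (z - w) • (𝒜.opOf W).resolvent z
  set QV := 1 + (z - w) • (𝒜.opOf V).resolvent z
  set P := 1 + (𝒜.opOf W).resolvent z * (V - W)
  have h : (𝒜.opOf W).resolvent z * (V - W) * (𝒜.opOf W).resolvent z = P * QV *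
      -((𝒜.opOf V).resolvent w * (W - V) * (𝒜.opOf W).resolvent w) * QW := by
    calc _ = P * (QV * (𝒜.opOf V).resolvent w) * (V - W) * ((𝒜.opOf W).resolvent w * QW) := by
          rw [← hV1, ← hW3, ← hW1]
      _ = _ := by noncomm_ring
  rw [h]
  exact ⟨_, (hC.mul_left (P * QV)).mul_right QW⟩

omit E in
theorem segment_mem (hV : V ∈ 𝒜.A0) (hW : W ∈ 𝒜.A0) (r : ℝ) :
    W + (r : ℂ) • (V - W) ∈ 𝒜.A0 := by
  rw [sub_eq_add_neg]
  exact 𝒜.add_mem hW (𝒜.smul_mem r (𝒜.add_mem hV (𝒜.neg_mem hW)))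

/-- Along the segment from `W` to `V`, the operators `R_s (V - W) R_r` factor through a single trace
class operator, with norm continuous coefficients; here `R_r` is the resolvent at `-i`. -/
theorem exists_segment_factorization (hV : V ∈ 𝒜.A0) (hW : W ∈ 𝒜.A0) (R : ℝ → 𝓗 →L[ℂ] 𝓗)
    (hR : ∀ r : ℝ, R r = (𝒜.opOf (W + (r : ℂ) • (V - W))).resolvent (-I)) :
    Continuous R ∧ (∀ s r, R s - R r = (-(s - r : ℝ) : ℂ) • (R s * (V - W) * R r)) ∧
    ∃ (T : 𝓗 →L[ℂ] 𝓗) (C : ℝ) (X Y : ℝ → 𝓗 →L[ℂ] 𝓗), TraceBound T C ∧ Continuous X ∧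
      Continuous Y ∧ ∀ s r, R s * (V - W) * R r = X s * T * Y r := by
  have hI : (-I).im ≠ 0 := by simp
  have hsub : ∀ s r, R s - R r = (-(s - r : ℝ) : ℂ) • (R s * (V - W) * R r) := fun s r => by
    have h := 𝒜.resolvent_sub_resolvent E (𝒜.segment_mem hV hW r) (𝒜.segment_mem hV hW s) hI
    rw [← hR, ← hR, show W + (r : ℂ) • (V - W) - (W + (s : ℂ) • (V - W))
      = (r - s : ℂ) • (V - W) by module, mul_smul_comm, smul_mul_assoc] at h
    rw [← neg_sub, h, neg_neg]
    congr 1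
    push_cast
    ring
  have hnorm : ∀ r, ‖R r‖ ≤ 1 := fun r => by
    rw [hR, (E _).resolvent_eq_fc hI]
    refine (E _).norm_fc_le (by fun_prop) fun x => ?_
    rw [norm_inv]
    refine inv_le_one_of_one_le₀ ?_
    simpa using Complex.abs_im_le_norm ((x : ℂ) - -I)
  have hcont : Continuous R := by
    refine LipschitzWith.continuous (K := ⟨‖V - W‖, norm_nonneg _⟩)
      (LipschitzWith.of_dist_le_mul fun s r => ?_)
    rw [dist_eq_norm, hsub, norm_smul, norm_neg, Complex.norm_real, dist_eq_norm, mul_comm]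
    refine mul_le_mul_of_nonneg_right ?_ (norm_nonneg _)
    refine (norm_mul_le _ _).trans ((mul_le_of_le_one_right (norm_nonneg _) (hnorm r)).trans ?_)
    exact (norm_mul_le _ _).trans (mul_le_of_le_one_left (norm_nonneg _) (hnorm s))
  obtain ⟨C, hC⟩ := 𝒜.exists_traceBound E hV hW hI
  have hR0 : R 0 = (𝒜.opOf W).resolvent (-I) := by simp [hR]
  rw [← hR0] at hC
  refine ⟨hcont, hsub, R 0 * (V - W) * R 0, C, fun s => 1 - (s : ℂ) • (R s * (V - W)),
    fun r => 1 - (r : ℂ) • ((V - W) * R r), hC, by fun_prop, by fun_prop, fun s r => ?_⟩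
  have hX : R s = (1 - (s : ℂ) • (R s * (V - W))) * R 0 := by
    have h := sub_eq_iff_eq_add'.1 (hsub s 0)
    rwa [sub_zero, neg_smul, ← sub_eq_add_neg, ← smul_mul_assoc, ← one_sub_mul] at h
  have hY : R r = R 0 * (1 - (r : ℂ) • ((V - W) * R r)) := by
    have h := sub_eq_iff_eq_add.1 (hsub 0 r)
    rw [zero_sub, Complex.ofReal_neg, neg_neg, mul_assoc, ← mul_smul_comm] at h
    rw [mul_sub, mul_one, eq_sub_iff_add_eq', ← h]
  calc R s * (V - W) * R r = (1 - (s : ℂ) • (R s * (V - W))) * R 0 * (V - W) *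
        (R 0 * (1 - (r : ℂ) • ((V - W) * R r))) := by rw [← hX, ← hY]
    _ = _ := by simp only [mul_assoc]

end AffineSetting

section Fourier

theorem exists_pow_mul_norm_fourierCoeffOn_le {a b : ℝ} (hab : a < b) (k : ℕ) {f : ℝ → ℂ}
    (hf : ContDiff ℝ (⊤ : ℕ∞) f) (hp : Function.Periodic f (b - a)) :
    ∃ C, ∀ n : ℤ, |(n : ℝ)| ^ k * ‖fourierCoeffOn hab f n‖ ≤ C := by
  induction k generalizing f with
  | zero =>
    obtain ⟨C, hC⟩ := (isCompact_uIcc (a := a) (b := b)).exists_bound_of_continuousOn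
      hf.continuous.continuousOn
    refine ⟨C, fun n => ?_⟩
    have h := intervalIntegral.norm_integral_le_of_norm_le_const (a := a) (b := b) (C := C)
      (f := fun x => fourier (-n) (x : AddCircle (b - a)) • f x) fun x hx => by
        rw [norm_smul, fourier_apply, Circle.norm_coe, one_mul]
        exact hC x (uIoc_subset_uIcc hx)
    have hba : 0 < b - a := sub_pos.2 hab
    rw [pow_zero, one_mul, fourierCoeffOn_eq_integral, norm_smul, norm_div, norm_one,
      Real.norm_of_nonneg hba.le, one_div_mul_eq_div, div_le_iff₀ hba]
    rwa [abs_of_pos hba] at h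
  | succ k ih =>
    have hd : ContDiff ℝ (⊤ : ℕ∞) (deriv f) := (contDiff_infty_iff_deriv.1 hf).2
    have hp' : Function.Periodic (deriv f) (b - a) := fun x => by
      rw [← deriv_comp_add_const, hp.funext]
    obtain ⟨C, hC⟩ := ih hd hp'
    refine ⟨(b - a) / (2 * π) * C, fun n => ?_⟩
    have hba : 0 < b - a := sub_pos.2 hab
    rcases eq_or_ne n 0 with rfl | hn
    · have hC0 : 0 ≤ C := le_trans (by positivity) (hC 0)
      rw [Int.cast_zero, abs_zero, zero_pow k.succ_ne_zero, zero_mul]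
      positivity
    · have hfb : f b = f a := by simpa using hp a
      rw [fourierCoeffOn_of_hasDerivAt hab hn
        (fun x _ => ((contDiff_infty_iff_deriv.1 hf).1 x).hasDerivAt)
        (hd.continuous.intervalIntegrable a b), hfb, sub_self, mul_zero, zero_sub]
      have hn' : |(n : ℝ)| ≠ 0 := by positivity
      refine le_trans (le_of_eq ?_) (mul_le_mul_of_nonneg_left (hC n)
        (by positivity : 0 ≤ (b - a) / (2 * π)))
      rw [norm_mul, norm_neg, norm_mul, ← Complex.ofReal_sub, Complex.norm_real,
        Real.norm_of_nonneg hba.le, norm_div]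
      simp only [norm_mul, norm_neg, norm_one, Complex.norm_I, Complex.norm_real,
        Complex.norm_intCast, Complex.norm_ofNat, Real.norm_of_nonneg Real.pi_pos.le]
      field_simp
      ring

theorem summable_abs_mul_norm_fourierCoeffOn {a b : ℝ} (hab : a < b) {f : ℝ → ℂ}
    (hf : ContDiff ℝ (⊤ : ℕ∞) f) (hp : Function.Periodic f (b - a)) :
    Summable fun n : ℤ => |(n : ℝ)| * ‖fourierCoeffOn hab f n‖ := by
  obtain ⟨C, hC⟩ := exists_pow_mul_norm_fourierCoeffOn_le hab 3 hf hp
  refine Summable.of_nonneg_of_le (fun n => by positivity) (fun n => ?_)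
    ((Real.summable_one_div_int_pow.2 one_lt_two).mul_left C)
  rcases eq_or_ne n 0 with rfl | hn
  · simp
  · have hn' : (0 : ℝ) < |(n : ℝ)| := by positivity
    rw [mul_one_div, le_div_iff₀ (by positivity), ← sq_abs]
    exact le_of_eq_of_le (by ring) (hC n)

theorem summable_of_summable_abs_mul {c : ℤ → ℂ} (h : Summable fun n : ℤ => |(n : ℝ)| * ‖c n‖) :
    Summable fun n => ‖c n‖ := by
  refine Summable.of_nonneg_of_le (fun n => norm_nonneg _) (fun n => ?_)
    (h.add (hasSum_ite_eq (0 : ℤ) ‖c 0‖).summable)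
  rcases eq_or_ne n 0 with rfl | hn
  · simp
  · rw [if_neg hn, add_zero]
    refine le_mul_of_one_le_left (norm_nonneg _) ?_
    exact_mod_cast Int.one_le_abs hn

/-- The function `φ ∘ tan`, extended by zero to the poles of the tangent. -/
def compTan (φ : ℝ → ℝ) (t : ℝ) : ℂ := if Real.cos t = 0 then 0 else (φ (Real.tan t) : ℂ)

theorem compTan_periodic (φ : ℝ → ℝ) : Function.Periodic (compTan φ) π := fun t => by
  simp [compTan, Real.cos_add_pi, Real.tan_add_pi]

theorem contDiff_compTan {φ : ℝ → ℝ} (hφ : ContDiff ℝ (⊤ : ℕ∞) φ) (hc : HasCompactSupport φ) :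
    ContDiff ℝ (⊤ : ℕ∞) (compTan φ) := by
  refine contDiff_iff_contDiffAt.2 fun t => ?_
  by_cases ht : Real.cos t = 0
  · have hz : ∀ᶠ s in 𝓝 t, compTan φ s = 0 := by
      obtain ⟨M, hM⟩ := hc.isCompact.isBounded.exists_norm_le
      have h := (Real.tendsto_abs_tan_of_cos_eq_zero ht).eventually_gt_atTop M
      rw [eventually_nhdsWithin_iff] at h
      filter_upwards [h] with s hs
      by_cases hcs : Real.cos s = 0
      · rw [compTan, if_pos hcs]
      · have hst : s ≠ t := fun h => hcs (h ▸ ht)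
        rw [compTan, if_neg hcs, image_eq_zero_of_notMem_tsupport fun hmem =>
          (hM _ hmem).not_gt (hs hst), Complex.ofReal_zero]
    exact (contDiffAt_const (c := (0 : ℂ))).congr_of_eventuallyEq hz
  · have hne : ∀ᶠ s in 𝓝 t, Real.cos s ≠ 0 := Real.continuous_cos.continuousAt.eventually_ne ht
    have h : ContDiffAt ℝ (⊤ : ℕ∞) (fun s => (φ (Real.tan s) : ℂ)) t :=
      Complex.ofRealCLM.contDiff.contDiffAt.comp t
        (hφ.contDiffAt.comp t (Real.contDiffAt_tan.2 ht))
    refine h.congr_of_eventuallyEq ?_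
    filter_upwards [hne] with s hs
    rw [compTan, if_neg hs]

theorem compTan_arctan (φ : ℝ → ℝ) (x : ℝ) : compTan φ (Real.arctan x) = φ x := by
  rw [compTan, if_neg (Real.cos_arctan_pos x).ne', Real.tan_arctan]

/-- The Cayley transform of the real line onto the unit circle without `-1`. -/
def cayley (x : ℝ) : ℂ := (I - x) / (x + I)

theorem ofReal_add_I_ne_zero (x : ℝ) : (x : ℂ) + I ≠ 0 := fun h => by
  simpa using congrArg Complex.im h

theorem cayley_eq (x : ℝ) : cayley x = 2 * I * ((x : ℂ) - -I)⁻¹ - 1 := by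
  have h := ofReal_add_I_ne_zero x
  rw [cayley, sub_neg_eq_add]
  field_simp
  ring

theorem norm_cayley (x : ℝ) : ‖cayley x‖ = 1 := by
  have h : I - (x : ℂ) = -starRingEnd ℂ ((x : ℂ) + I) := by
    simp [sub_eq_add_neg, add_comm]
  rw [cayley, norm_div, h, norm_neg, RCLike.norm_conj,
    div_self (norm_ne_zero_iff.2 (ofReal_add_I_ne_zero x))]

theorem cayley_ne_zero (x : ℝ) : cayley x ≠ 0 := by
  rw [← norm_ne_zero_iff, norm_cayley]
  exact one_ne_zero

theorem cayley_eq_exp_arctan (x : ℝ) : cayley x = Complex.exp (2 * I * Real.arctan x) := by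
  have h : Complex.exp (2 * I * Real.arctan x)
      = (Complex.cos (Real.arctan x) + Complex.sin (Real.arctan x) * I) ^ 2 := by
    rw [← Complex.exp_mul_I, ← Complex.exp_nat_mul]
    congr 1
    push_cast
    ring
  have hx := ofReal_add_I_ne_zero x
  have hs : ((√(1 + x ^ 2) : ℝ) : ℂ) ^ 2 = 1 + (x : ℂ) ^ 2 := by
    rw [← Complex.ofReal_pow, Real.sq_sqrt (by positivity)]
    push_cast
    ring
  have hs0 : (1 + (x : ℂ) ^ 2) ≠ 0 := by exact_mod_cast (by positivity : (1 + x ^ 2 : ℝ) ≠ 0)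
  rw [h, ← Complex.ofReal_cos, ← Complex.ofReal_sin, Real.cos_arctan, Real.sin_arctan]
  push_cast
  rw [show (1 / ((√(1 + x ^ 2) : ℝ) : ℂ) + x / ((√(1 + x ^ 2) : ℝ) : ℂ) * I) ^ 2
    = (1 + x * I) ^ 2 / ((√(1 + x ^ 2) : ℝ) : ℂ) ^ 2 by ring, hs, cayley,
    div_eq_div_iff hx hs0]
  linear_combination -(2 * x + x ^ 3 + x ^ 2 * I : ℂ) * Complex.I_sq

theorem hasDerivAt_cayley (x : ℝ) : HasDerivAt cayley (-2 * I / ((x : ℂ) + I) ^ 2) x := by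
  have hx := ofReal_add_I_ne_zero x
  have h := ((Complex.ofRealCLM.hasDerivAt (x := x)).const_sub I).div
    ((Complex.ofRealCLM.hasDerivAt (x := x)).add_const I) hx
  refine h.congr_deriv ?_
  simp only [Complex.ofRealCLM_apply, Complex.ofReal_one]
  ring

theorem continuous_cayley : Continuous cayley :=
  continuous_iff_continuousAt.2 fun x => (hasDerivAt_cayley x).continuousAt

/-- Smooth compactly supported functions expand into rapidly convergent series of powers of the
Cayley transform. -/
theorem exists_hasSum_cayley {φ : ℝ → ℝ} (hφ : ContDiff ℝ (⊤ : ℕ∞) φ) (hc : HasCompactSupport φ) :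
    ∃ c : ℤ → ℂ, (Summable fun n : ℤ => |(n : ℝ)| * ‖c n‖) ∧
      ∀ x, HasSum (fun n => c n * cayley x ^ n) (φ x : ℂ) := by
  have : Fact (0 < π) := ⟨Real.pi_pos⟩
  have hper := compTan_periodic φ
  have hsmooth := contDiff_compTan hφ hc
  have hab : -(π / 2) < -(π / 2) + π := lt_add_of_pos_right _ Real.pi_pos
  have hs := summable_abs_mul_norm_fourierCoeffOn hab hsmooth (by rwa [add_sub_cancel_left])
  refine ⟨fourierCoeffOn hab (compTan φ), hs, fun x => ?_⟩
  let f : C(AddCircle π, ℂ) := ⟨AddCircle.liftIoc π (-(π / 2)) (compTan φ),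
    AddCircle.liftIoc_continuous (hper _).symm hsmooth.continuous.continuousOn⟩
  have hcoef : fourierCoeff f = fourierCoeffOn hab (compTan φ) := by
    ext n
    exact fourierCoeff_liftIoc_eq _ n
  have hsum := has_pointwise_sum_fourier_series_of_summable (f := f)
    (hcoef ▸ (summable_of_summable_abs_mul hs).of_norm) (Real.arctan x : AddCircle π)
  have hfx : f (Real.arctan x : AddCircle π) = φ x := by
    rw [← compTan_arctan]
    change AddCircle.liftIoc π (-(π / 2)) (compTan φ) _ = _
    refine AddCircle.liftIoc_coe_apply ⟨Real.neg_pi_div_two_lt_arctan x, ?_⟩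
    linarith [Real.arctan_lt_pi_div_two x]
  rw [hfx, hcoef] at hsum
  convert hsum using 2 with n
  rw [smul_eq_mul, fourier_coe_apply, cayley_eq_exp_arctan, ← Complex.exp_int_mul]
  congr 2
  have hpi : (π : ℂ) ≠ 0 := Complex.ofReal_ne_zero.2 Real.pi_ne_zero
  field_simp

theorem hasSum_deriv_cayley {φ : ℝ → ℝ} (hφ : Differentiable ℝ φ) {c : ℤ → ℂ}
    (hs : Summable fun n : ℤ => |(n : ℝ)| * ‖c n‖)
    (hc : ∀ x, HasSum (fun n => c n * cayley x ^ n) (φ x : ℂ)) (x : ℝ) :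
    HasSum (fun n : ℤ => n * (-2 * I) * (c n * cayley x ^ (n - 1)))
      (((x : ℂ) + I) ^ 2 * ((deriv φ x : ℝ) : ℂ)) := by
  have hderiv : ∀ (n : ℤ) (y : ℝ), HasDerivAt (fun y => c n * cayley y ^ n)
      (c n * (n * cayley y ^ (n - 1) * (-2 * I / ((y : ℂ) + I) ^ 2))) y := fun n y =>
    ((hasDerivAt_zpow n _ (.inl (cayley_ne_zero y))).comp y (hasDerivAt_cayley y)).const_mul _
  have hbound : ∀ (n : ℤ) (y : ℝ),
      ‖c n * (n * cayley y ^ (n - 1) * (-2 * I / ((y : ℂ) + I) ^ 2))‖ ≤ 2 * (|(n : ℝ)| * ‖c n‖) :=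
    fun n y => by
      have h1 : 1 ≤ ‖(y : ℂ) + I‖ := by simpa using Complex.abs_im_le_norm ((y : ℂ) + I)
      simp only [norm_mul, norm_div, norm_pow, norm_zpow, norm_cayley, norm_neg, Complex.norm_I,
        Complex.norm_intCast, Complex.norm_ofNat, one_zpow, mul_one]
      have h2 : 2 / ‖(y : ℂ) + I‖ ^ 2 ≤ 2 := div_le_self zero_le_two (one_le_pow₀ h1)
      calc _ = |(n : ℝ)| * ‖c n‖ * (2 / ‖(y : ℂ) + I‖ ^ 2) := by ring
        _ ≤ |(n : ℝ)| * ‖c n‖ * 2 := by gcongr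
        _ = _ := by ring
  have h := hasDerivAt_tsum (hs.mul_left 2) hderiv hbound (hc 0).summable x
  have hφ' : HasDerivAt (fun y => ∑' n, c n * cayley y ^ n) ((deriv φ x : ℝ) : ℂ) x := by
    simp only [fun y => (hc y).tsum_eq]
    exact (hφ x).hasDerivAt.ofReal_comp
  have hsum : HasSum (fun n : ℤ => c n * (n * cayley x ^ (n - 1) * (-2 * I / ((x : ℂ) + I) ^ 2)))
      ((deriv φ x : ℝ) : ℂ) := by
    rw [hφ'.unique h]
    exact (Summable.of_norm_bounded (hs.mul_left 2) fun n => hbound n x).hasSum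
  have hx := ofReal_add_I_ne_zero x
  have hterm : ∀ n : ℤ, n * (-2 * I) * (c n * cayley x ^ (n - 1)) = ((x : ℂ) + I) ^ 2 *
      (c n * (n * cayley x ^ (n - 1) * (-2 * I / ((x : ℂ) + I) ^ 2))) := fun n => by
    field_simp
  simpa only [hterm] using hsum.mul_left (((x : ℂ) + I) ^ 2)

end Fourier

section CayleyPath

theorem isBddBorel_cayley_zpow (n : ℤ) : IsBddBorel fun x => cayley x ^ n :=
  ⟨(continuous_cayley.zpow₀ n fun x => .inl (cayley_ne_zero x)).measurable, 1,
    fun x => by rw [norm_zpow, norm_cayley, one_zpow]⟩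

namespace SpectralMeasure

variable {H : SelfAdjointOperator 𝓗} (E : SpectralMeasure H)

theorem fc_pow {φ : ℝ → ℂ} (hφ : IsBddBorel φ) (n : ℕ) : E.fc φ ^ n = E.fc fun x => φ x ^ n := by
  have hb : ∀ n : ℕ, IsBddBorel fun x => φ x ^ n := fun n => by
    induction n with
    | zero => simpa using IsBddBorel.const 1
    | succ n ih => simpa only [pow_succ] using ih.mul hφ
  induction n with
  | zero => simp only [pow_zero, E.fc_one]
  | succ n ih => simp only [pow_succ, ih, E.fc_mul (hb n) hφ]

theorem fc_cayley : E.fc cayley = (2 * I) • H.resolvent (-I) - 1 := by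
  have hI : (-I).im ≠ 0 := by simp
  have hb := (isBddBorel_resolvent hI).const_mul (2 * I)
  rw [show cayley = fun x : ℝ => 2 * I * ((x : ℂ) - -I)⁻¹ + -1 from
    funext fun x => (cayley_eq x).trans (sub_eq_add_neg _ _), E.fc_add hb (.const (-1)),
    E.fc_const_mul _ (isBddBorel_resolvent hI), ← E.resolvent_eq_fc hI,
    show (fun _ : ℝ => (-1 : ℂ)) = fun _ => -1 * 1 by simp, E.fc_const_mul _ (.const 1), E.fc_one]
  module

theorem fc_cayley_zpow_mul (m n : ℤ) : (E.fc fun x => cayley x ^ m) * (E.fc fun x => cayley x ^ n)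
    = E.fc fun x => cayley x ^ (m + n) := by
  rw [E.fc_mul (isBddBorel_cayley_zpow m) (isBddBorel_cayley_zpow n)]
  simp only [zpow_add₀ (cayley_ne_zero _)]

theorem fc_cayley_zpow_neg (n : ℤ) :
    (E.fc fun x => cayley x ^ (-n)) = star (E.fc fun x => cayley x ^ n) := by
  rw [← E.fc_conj (isBddBorel_cayley_zpow n)]
  congr 1
  ext x
  rw [zpow_neg, Complex.inv_def, Complex.normSq_eq_norm_sq, norm_zpow, norm_cayley]
  simp

theorem norm_fc_cayley_zpow_le (n : ℤ) : ‖E.fc fun x => cayley x ^ n‖ ≤ 1 :=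
  E.norm_fc_le (isBddBorel_cayley_zpow n).1 fun x => by rw [norm_zpow, norm_cayley, one_zpow]

end SpectralMeasure

variable {H : ℝ → SelfAdjointOperator 𝓗} (F : ∀ r, SpectralMeasure (H r))
  {T : 𝓗 →L[ℂ] 𝓗} {C : ℝ} {X Y : ℝ → 𝓗 →L[ℂ] 𝓗}

theorem continuous_fc_cayley_zpow (hR : Continuous fun r => (H r).resolvent (-I)) (n : ℤ) :
    Continuous fun r => (F r).fc fun x => cayley x ^ n := by
  have hpow : ∀ n : ℕ, Continuous fun r => (F r).fc fun x => cayley x ^ (n : ℤ) := fun n => by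
    have h1 : IsBddBorel cayley := by simpa using isBddBorel_cayley_zpow 1
    simp only [zpow_natCast, ← (F _).fc_pow h1, (F _).fc_cayley]
    fun_prop
  obtain ⟨m, rfl | rfl⟩ := n.eq_nat_or_neg
  · exact hpow m
  · simp only [(F _).fc_cayley_zpow_neg]
    exact continuous_star.comp (hpow m)

variable (hR : Continuous fun r => (H r).resolvent (-I))
  (hT : TraceBound T C) (hX : Continuous X) (hY : Continuous Y)
  (hsub : ∀ s r, (H s).resolvent (-I) - (H r).resolvent (-I) =
    (-(s - r : ℝ) : ℂ) • (X s * T * Y r))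

include hsub in
theorem fc_cayley_sub (s r : ℝ) :
    ((F s).fc fun x => cayley x ^ (1 : ℤ)) - ((F r).fc fun x => cayley x ^ (1 : ℤ)) =
      (-2 * I * (s - r : ℝ)) • (X s * T * Y r) := by
  simp only [zpow_one]
  rw [(F s).fc_cayley, (F r).fc_cayley, sub_sub_sub_cancel_right, ← smul_sub, hsub, smul_smul]
  congr 1
  ring

include hsub in
theorem fc_cayley_inv_sub (s r : ℝ) :
    ((F s).fc fun x => cayley x ^ (-1 : ℤ)) - ((F r).fc fun x => cayley x ^ (-1 : ℤ)) =
      (2 * I * (s - r : ℝ)) • (((F s).fc fun x => cayley x ^ (-1 : ℤ)) * X s * T *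
        (Y r * (F r).fc fun x => cayley x ^ (-1 : ℤ))) := by
  have h1 : ∀ t, ((F t).fc fun x => cayley x ^ (-1 : ℤ)) * ((F t).fc fun x => cayley x ^ (1 : ℤ))
      = 1 := fun t => by
    rw [(F t).fc_cayley_zpow_mul]
    simpa using (F t).fc_one
  have h2 : ∀ t, ((F t).fc fun x => cayley x ^ (1 : ℤ)) * ((F t).fc fun x => cayley x ^ (-1 : ℤ))
      = 1 := fun t => by
    rw [(F t).fc_cayley_zpow_mul]
    simpa using (F t).fc_one
  have h := fc_cayley_sub F hsub s r
  set U := fun t => (F t).fc fun x => cayley x ^ (1 : ℤ)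
  set V := fun t => (F t).fc fun x => cayley x ^ (-1 : ℤ)
  calc V s - V r = -(V s * (U s - U r) * V r) := by
        rw [mul_sub, sub_mul, h1 s, mul_assoc, h2 r]
        simp
    _ = _ := by
        rw [h, mul_smul_comm, smul_mul_assoc, ← neg_smul]
        simp only [mul_assoc]
        congr 1
        ring

include hT hsub in
theorem exists_traceBound_fc_cayley_zpow_sub : ∃ K, ∀ n : ℤ,
    TraceBound (((F 1).fc fun x => cayley x ^ n) - ((F 0).fc fun x => cayley x ^ n))
      (|(n : ℝ)| * K) := by
  set K₁ := ‖(-2 * I * (1 - 0 : ℝ) : ℂ)‖ * (4 * ‖X 1‖ * ‖Y 0‖ * C)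
  set K₂ := ‖(2 * I * (1 - 0 : ℝ) : ℂ)‖ * (4 * ‖((F 1).fc fun x => cayley x ^ (-1 : ℤ)) * X 1‖ *
    ‖Y 0 * (F 0).fc fun x => cayley x ^ (-1 : ℤ)‖ * C)
  refine ⟨max K₁ K₂, fun n => ?_⟩
  obtain ⟨m, rfl | rfl⟩ := n.eq_nat_or_neg
  · have h := hT.pow_sub_pow (fc_cayley_sub F hsub) (fun s => (F s).norm_fc_cayley_zpow_le 1) m 1 0
    simp only [(F _).fc_pow (isBddBorel_cayley_zpow _), ← zpow_natCast, ← zpow_mul, one_mul] at h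
    refine h.mono ?_
    rw [Int.cast_natCast, Nat.abs_cast]
    exact mul_le_mul_of_nonneg_left (le_max_left _ _) (Nat.cast_nonneg m)
  · have h := hT.pow_sub_pow (fc_cayley_inv_sub F hsub)
      (fun s => (F s).norm_fc_cayley_zpow_le (-1)) m 1 0
    simp only [(F _).fc_pow (isBddBorel_cayley_zpow _), ← zpow_natCast, ← zpow_mul,
      neg_one_mul] at h
    refine h.mono ?_
    rw [Int.cast_neg, abs_neg, Int.cast_natCast, Nat.abs_cast]
    exact mul_le_mul_of_nonneg_left (le_max_right _ _) (Nat.cast_nonneg m)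

include hR hX hY hsub in
theorem trace_fc_cayley_zpow_sub (n : ℤ) :
    trace (((F 1).fc fun x => cayley x ^ n) - ((F 0).fc fun x => cayley x ^ n)) =
      ∫ r in (0 : ℝ)..1, n * (-2 * I) *
        hT.functional (Y r * ((F r).fc fun x => cayley x ^ (n - 1)) * X r) := by
  have hc := continuous_fc_cayley_zpow F hR
  obtain ⟨m, rfl | rfl⟩ := n.eq_nat_or_neg
  · have h := hT.trace_pow_sub_pow (fc_cayley_sub F hsub)
      (fun s => (F s).norm_fc_cayley_zpow_le 1) (hc 1) hX hY m
    simp only [(F _).fc_pow (isBddBorel_cayley_zpow _), ← zpow_natCast, ← zpow_mul, one_mul] at h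
    rw [h]
    refine intervalIntegral.integral_congr fun r _ => ?_
    cases m with
    | zero => simp
    | succ m => simp
  · have h := hT.trace_pow_sub_pow (fc_cayley_inv_sub F hsub)
      (fun s => (F s).norm_fc_cayley_zpow_le (-1)) (hc (-1)) ((hc (-1)).mul hX)
      (hY.mul (hc (-1))) m
    simp only [(F _).fc_pow (isBddBorel_cayley_zpow _), ← zpow_natCast, ← zpow_mul,
      neg_one_mul] at h
    rw [h]
    refine intervalIntegral.integral_congr fun r _ => ?_
    cases m with
    | zero => simp
    | succ m =>
      have hmul : Y r * ((F r).fc fun x => cayley x ^ (-1 : ℤ)) *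
          ((F r).fc fun x => cayley x ^ (-(m : ℤ))) *
          (((F r).fc fun x => cayley x ^ (-1 : ℤ)) * X r)
          = Y r * ((F r).fc fun x => cayley x ^ (-((m + 1 : ℕ) : ℤ) - 1)) * X r := by
        rw [show (-((m + 1 : ℕ) : ℤ) - 1) = -1 + (-(m : ℤ) + -1) by push_cast; ring,
          ← (F r).fc_cayley_zpow_mul, ← (F r).fc_cayley_zpow_mul]
        simp only [mul_assoc]
      simp only [Nat.add_sub_cancel, hmul]
      push_cast
      ring

include hR hX hY hsub in
/-- The trace formula for functions with a rapidly convergent expansion in powers of the Cayley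
transform. -/
theorem trace_fc_sub {φ g : ℝ → ℂ} {c : ℤ → ℂ} (hφ : IsBddBorel φ) (hg : IsBddBorel g)
    (hs : Summable fun n : ℤ => |(n : ℝ)| * ‖c n‖)
    (hφc : ∀ x, HasSum (fun n => c n * cayley x ^ n) (φ x))
    (hgc : ∀ x, HasSum (fun n : ℤ => n * (-2 * I) * (c n * cayley x ^ (n - 1))) (g x)) :
    IsTraceClass ((F 1).fc φ - (F 0).fc φ) ∧
    Continuous (fun r => hT.functional (Y r * (F r).fc g * X r)) ∧
    trace ((F 1).fc φ - (F 0).fc φ) =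
      ∫ r in (0 : ℝ)..1, hT.functional (Y r * (F r).fc g * X r) := by
  have hu := norm_cayley
  have hexp : ∀ r, HasSum (fun n => c n • (F r).fc fun x => cayley x ^ n) ((F r).fc φ) :=
      fun r => by
    simp only [← (F r).fc_const_mul _ (isBddBorel_cayley_zpow _)]
    exact (F r).hasSum_fc (fun n => ((isBddBorel_cayley_zpow n).const_mul _).1)
      (fun n x => by rw [norm_mul, norm_zpow, hu, one_zpow, mul_one])
      (summable_of_summable_abs_mul hs) hφ hφc
  have hexp' : ∀ r, HasSum (fun n : ℤ => (n * (-2 * I) * c n) •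
      (F r).fc fun x => cayley x ^ (n - 1)) ((F r).fc g) := fun r => by
    simp only [← (F r).fc_const_mul _ (isBddBorel_cayley_zpow _)]
    refine (F r).hasSum_fc (fun n => ((isBddBorel_cayley_zpow _).const_mul _).1)
      (fun n x => le_of_eq ?_) (hs.mul_left 2) hg (by simpa only [mul_assoc] using hgc)
    simp only [norm_mul, norm_zpow, hu, one_zpow, norm_neg, Complex.norm_I, Complex.norm_intCast,
      Complex.norm_ofNat]
    ring
  have hc := continuous_fc_cayley_zpow F hR
  obtain ⟨K, hK⟩ := exists_traceBound_fc_cayley_zpow_sub F hT hsub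
  have hdiff : HasSum (fun n => c n • (((F 1).fc fun x => cayley x ^ n) -
      ((F 0).fc fun x => cayley x ^ n))) ((F 1).fc φ - (F 0).fc φ) := by
    simpa only [smul_sub] using (hexp 1).sub (hexp 0)
  obtain ⟨hTB, htr⟩ := TraceBound.hasSum_series (fun n => (hK n).smul (c n))
    ((hs.mul_right K).congr fun n => by ring) hdiff
  have hcont : Continuous fun r => (F r).fc g := by
    simp only [← fun r => (hexp' r).tsum_eq]
    refine continuous_tsum (fun n => by have := hc (n - 1); fun_prop) (hs.mul_left 2) fun n r => ?_
    rw [norm_smul]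
    refine (mul_le_of_le_one_right (norm_nonneg _) ((F r).norm_fc_cayley_zpow_le _)).trans
      (le_of_eq ?_)
    simp only [norm_mul, norm_neg, Complex.norm_I, Complex.norm_intCast, Complex.norm_ofNat]
    ring
  refine ⟨⟨_, hTB⟩, by fun_prop, htr.unique ?_⟩
  simp only [trace_smul, trace_fc_cayley_zpow_sub F hR hT hX hY hsub,
    ← intervalIntegral.integral_const_mul]
  refine intervalIntegral.hasSum_integral_of_dominated_convergence
    (fun n r => |(n : ℝ)| * ‖c n‖ * (2 * (‖hT.functional‖ * (‖Y r‖ * ‖X r‖))))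
    (fun n => Continuous.aestronglyMeasurable (by have := hc (n - 1); fun_prop))
    (fun n => Eventually.of_forall fun r _ => ?_)
    (Eventually.of_forall fun r _ => hs.mul_right _) ?_
    (Eventually.of_forall fun r _ => ?_)
  · have h1 : ‖hT.functional (Y r * ((F r).fc fun x => cayley x ^ (n - 1)) * X r)‖
        ≤ ‖hT.functional‖ * (‖Y r‖ * ‖X r‖) := by
      refine (hT.functional.le_opNorm _).trans ?_
      gcongr
      refine (norm_mul_le _ _).trans (mul_le_mul_of_nonneg_right ?_ (norm_nonneg _))
      exact (norm_mul_le _ _).trans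
        (mul_le_of_le_one_right (norm_nonneg _) ((F r).norm_fc_cayley_zpow_le _))
    simp only [norm_mul, norm_neg, Complex.norm_I, Complex.norm_intCast, Complex.norm_ofNat,
      mul_one]
    calc _ = |(n : ℝ)| * ‖c n‖ * (2 *
          ‖hT.functional (Y r * ((F r).fc fun x => cayley x ^ (n - 1)) * X r)‖) := by ring
      _ ≤ _ := by gcongr
  · simp only [tsum_mul_right]
    exact Continuous.intervalIntegrable (by fun_prop) 0 1
  · have h := hT.functional.hasSum (((hexp' r).mul_left (Y r)).mul_right (X r))
    simp only [mul_smul_comm, smul_mul_assoc, map_smul, smul_eq_mul] at h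
    have hterm : ∀ (n : ℤ) (w : ℂ), c n * (n * (-2 * I) * w) = n * (-2 * I) * c n * w :=
      fun n w => by ring
    simpa only [hterm] using h

end CayleyPath

section PhiMeas

theorem _root_.HasCompactSupport.isBddBorel {f : ℝ → ℂ} (hf : HasCompactSupport f)
    (hc : Continuous f) : IsBddBorel f :=
  ⟨hc.measurable, hf.exists_bound_of_continuous hc⟩

/-- The operator `E_H(supp φ) V φ(H)` in terms of `R V R`, where `R` is the resolvent at `-i`. -/
theorem SpectralMeasure.phiMeas_eq {H : SelfAdjointOperator 𝓗} (E : SpectralMeasure H)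
    {V T X Y : 𝓗 →L[ℂ] 𝓗} {C : ℝ} (hT : TraceBound T C)
    (hfac : H.resolvent (-I) * V * H.resolvent (-I) = X * T * Y)
    {φ : ℝ → ℝ} (hφ : Continuous φ) (hc : HasCompactSupport φ) :
    PhiMeas E V φ =
      (hT.functional (Y * (E.fc fun x => ((x : ℂ) + I) ^ 2 * (φ x : ℂ)) * X)).re := by
  have hI : (-I).im ≠ 0 := by simp
  have hs : MeasurableSet (tsupport φ) := (isClosed_tsupport φ).measurableSet
  have hcℂ : HasCompactSupport fun x => (φ x : ℂ) := hc.comp_left Complex.ofReal_zero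
  have hη : IsBddBorel fun x : ℝ => ((x : ℂ) + I) * (φ x : ℂ) :=
    HasCompactSupport.isBddBorel (f := fun x : ℝ => ((x : ℂ) + I) * (φ x : ℂ))
      (hcℂ.mul_left) (by fun_prop)
  have hχ : IsBddBorel ((tsupport φ).indicator fun x : ℝ => (x : ℂ) + I) := by
    obtain ⟨M, hM⟩ := hc.isCompact.exists_bound_of_continuousOn
      (f := fun x : ℝ => (x : ℂ) + I) (by fun_prop)
    refine ⟨Measurable.indicator (by fun_prop) hs, max M 0, fun x => ?_⟩
    by_cases hx : x ∈ tsupport φ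
    · rw [indicator_of_mem hx]
      exact (hM x hx).trans (le_max_left _ _)
    · rw [indicator_of_notMem hx, norm_zero]
      exact le_max_right _ _
  have hproj : E.proj (tsupport φ) =
      E.fc ((tsupport φ).indicator fun x : ℝ => (x : ℂ) + I) * H.resolvent (-I) := by
    rw [E.resolvent_eq_fc hI, E.fc_mul hχ (isBddBorel_resolvent hI), ← E.fc_indicator_one hs]
    congr 1
    ext x
    have hx := ofReal_add_I_ne_zero x
    by_cases hxs : x ∈ tsupport φ <;> simp [hxs, hx]
  have hfc : E.fcR φ = H.resolvent (-I) * E.fc fun x => ((x : ℂ) + I) * (φ x : ℂ) := by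
    rw [E.resolvent_eq_fc hI, E.fc_mul (isBddBorel_resolvent hI) hη, SpectralMeasure.fcR]
    congr 1
    ext x
    have hx := ofReal_add_I_ne_zero x
    rw [sub_neg_eq_add, inv_mul_cancel_left₀ hx]
  have hprod : (E.fc fun x => ((x : ℂ) + I) * (φ x : ℂ)) *
      E.fc ((tsupport φ).indicator fun x : ℝ => (x : ℂ) + I) =
      E.fc fun x => ((x : ℂ) + I) ^ 2 * (φ x : ℂ) := by
    rw [E.fc_mul hη hχ]
    congr 1
    ext x
    by_cases hxs : x ∈ tsupport φ
    · rw [indicator_of_mem hxs]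
      ring
    · simp [image_eq_zero_of_notMem_tsupport hxs]
  have hop : E.proj (tsupport φ) ∘L (V ∘L E.fcR φ) =
      E.fc ((tsupport φ).indicator fun x : ℝ => (x : ℂ) + I) * X * T *
        (Y * E.fc fun x => ((x : ℂ) + I) * (φ x : ℂ)) := by
    change E.proj (tsupport φ) * (V * E.fcR φ) = _
    set χ := E.fc ((tsupport φ).indicator fun x : ℝ => (x : ℂ) + I)
    set η := E.fc fun x => ((x : ℂ) + I) * (φ x : ℂ)
    calc E.proj (tsupport φ) * (V * E.fcR φ)
        = χ * (H.resolvent (-I) * V * H.resolvent (-I)) * η := by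
          rw [hproj, hfc]
          simp only [mul_assoc]
      _ = _ := by
          rw [hfac]
          simp only [mul_assoc]
  rw [PhiMeas, hop, hT.trace_mul_mul, ← hprod]
  simp only [mul_assoc]

theorem SpectralMeasure.isSelfAdjoint_fcR {H : SelfAdjointOperator 𝓗} (E : SpectralMeasure H)
    {φ : ℝ → ℝ} (hφ : IsBddBorel fun x => (φ x : ℂ)) : IsSelfAdjoint (E.fcR φ) := by
  rw [IsSelfAdjoint, SpectralMeasure.fcR, ← E.fc_conj hφ]
  simp only [Complex.conj_ofReal]

end PhiMeas

/-- In the affine setting `𝒜 = H₀ + 𝒜₀`, the trace formula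
`Tr(φ(H₁) − φ(H₀)) = ξ(φ'; H₁, H₀)` holds for all `H₀, H₁ ∈ 𝒜` and test functions `φ`,
where `ξ(·; H₁, H₀)` is the spectral shift measure given by the Birman–Solomyak
formula along the straight line from `H₀` to `H₁`. -/
theorem trace_formula
    (𝓗 : Type) [NormedAddCommGroup 𝓗] [InnerProductSpace ℂ 𝓗] [CompleteSpace 𝓗]
    (𝒜 : AffineSetting 𝓗)
    (E : ∀ V : 𝓗 →L[ℂ] 𝓗, SpectralMeasure (𝒜.opOf V))
    (W₀ W₁ : 𝓗 →L[ℂ] 𝓗) (hW₀ : W₀ ∈ 𝒜.A0) (hW₁ : W₁ ∈ 𝒜.A0)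
    (φ : ℝ → ℝ) (hφ : ContDiff ℝ (⊤ : ℕ∞) φ) (hφc : HasCompactSupport φ) :
    IsTraceClass ((E W₁).fcR φ - (E W₀).fcR φ) ∧
    IntervalIntegrable
      (fun r : ℝ => PhiMeas (E (W₀ + (r : ℂ) • (W₁ - W₀))) (W₁ - W₀) (deriv φ))
      MeasureTheory.volume 0 1 ∧
    trace ((E W₁).fcR φ - (E W₀).fcR φ)
      = ((∫ r in (0:ℝ)..1,
          PhiMeas (E (W₀ + (r : ℂ) • (W₁ - W₀))) (W₁ - W₀) (deriv φ) : ℝ) : ℂ) := by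
  set V : ℝ → 𝓗 →L[ℂ] 𝓗 := fun r => W₀ + (r : ℂ) • (W₁ - W₀) with hV
  have hV0 : V 0 = W₀ := by simp [hV]
  have hV1 : V 1 = W₁ := by simp [hV]
  obtain ⟨hR, hsub, T, C, X, Y, hT, hX, hY, hfac⟩ := 𝒜.exists_segment_factorization E hW₁ hW₀
    (fun r => (𝒜.opOf (V r)).resolvent (-I)) fun _ => rfl
  obtain ⟨c, hs, hφsum⟩ := exists_hasSum_cayley hφ hφc
  have hdφ : Continuous (deriv φ) := (contDiff_infty_iff_deriv.1 hφ).2.continuous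
  have hdc : HasCompactSupport fun x => ((deriv φ x : ℝ) : ℂ) :=
    hφc.deriv.comp_left Complex.ofReal_zero
  have hφb : IsBddBorel fun x => (φ x : ℂ) :=
    HasCompactSupport.isBddBorel (hφc.comp_left Complex.ofReal_zero)
      (Complex.continuous_ofReal.comp hφ.continuous)
  have hgb : IsBddBorel fun x : ℝ => ((x : ℂ) + I) ^ 2 * ((deriv φ x : ℝ) : ℂ) :=
    HasCompactSupport.isBddBorel (f := fun x : ℝ => ((x : ℂ) + I) ^ 2 * ((deriv φ x : ℝ) : ℂ))
      hdc.mul_left (by fun_prop)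
  obtain ⟨htc, hcont, htr⟩ := trace_fc_sub (fun r => E (V r)) hR hT hX hY
    (fun s r => by rw [← hfac, ← hsub]) hφb hgb hs hφsum
    (hasSum_deriv_cayley (contDiff_infty_iff_deriv.1 hφ).1 hs hφsum)
  rw [hV0, hV1] at htc htr
  have hphi : ∀ r : ℝ, PhiMeas (E (W₀ + (r : ℂ) • (W₁ - W₀))) (W₁ - W₀) (deriv φ) =
      (hT.functional (Y r * ((E (V r)).fc fun x => ((x : ℂ) + I) ^ 2 * ((deriv φ x : ℝ) : ℂ)) *
        X r)).re :=
    fun r => (E (V r)).phiMeas_eq hT (hfac r r) hdφ hφc.deriv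
  have hint : IntervalIntegrable (fun r => hT.functional
      (Y r * ((E (V r)).fc fun x => ((x : ℂ) + I) ^ 2 * ((deriv φ x : ℝ) : ℂ)) * X r)) volume 0 1 :=
    hcont.intervalIntegrable 0 1
  have him : (trace ((E W₁).fcR φ - (E W₀).fcR φ)).im = 0 :=
    trace_im_eq_zero (((E W₁).isSelfAdjoint_fcR hφb).sub ((E W₀).isSelfAdjoint_fcR hφb))
  refine ⟨htc, ?_, ?_⟩
  · simp only [hphi]
    exact (Complex.continuous_re.comp hcont).intervalIntegrable 0 1
  · simp only [hphi]
    refine Complex.ext ?_ (by rw [him, Complex.ofReal_im])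
    rw [Complex.ofReal_re]
    refine (congrArg Complex.re htr).trans ?_
    exact (Complex.reCLM.intervalIntegral_comp_comm hint).symm

end SSF
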